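/- Let d, d' ∈ ℕ and let f : [-1,1]² → ℝ be continuous. Then f ∈ 𝒫(S^d, S^{d'}) if and only if there exist real numbers f̂_{n,m} ≥ 0 with ∑_{n,m=0}^∞ f̂_{n,m} < ∞ such that f(x,y) = ∑_{n,m=0}^∞ f̂_{n,m} c_n(d,x) c_m(d',y) for all x, y ∈ [-1,1]. In that case the double series converges uniformly on [-1,1]², and the coefficients are given by f̂_{n,m} = (N_n(d)σ_{d-1}/σ_d)(N_m(d')σ_{d'-1}/σ_{d'}) ∫_{-1}^1 ∫_{-1}^1 f(x,y) c_n(d,x) c_m(d',y) (1-x²)^{d/2-1} (1-y²)^{d'/2-1} dx dy. -/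

import Mathlib

open scoped RealInnerProductSpace BigOperators ComplexOrder
open Polynomial MeasureTheory Filter

/-- Gegenbauer polynomial `C_n^{(λ)}(x)` via its explicit formula. -/
noncomputable def gegenbauerC (lam : ℝ) (n : ℕ) (x : ℝ) : ℝ :=
  ∑ k ∈ Finset.range (n / 2 + 1),
    (-1 : ℝ) ^ k * ((ascPochhammer ℝ (n - k)).eval lam /
      ((Nat.factorial k : ℝ) * (Nat.factorial (n - 2 * k) : ℝ))) * (2 * x) ^ (n - 2 * k)

/-- Chebyshev polynomial of the first kind, evaluated at a real number. -/
noncomputable def chebyshevT (n : ℕ) (x : ℝ) : ℝ := (Polynomial.Chebyshev.T ℝ (n : ℤ)).eval x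

/-- Normalized ultraspherical polynomials `c_n(d,x)`: for `d ≥ 2` the Gegenbauer polynomial
with parameter `λ = (d-1)/2` normalized to be `1` at `x = 1`; for `d = 1` the Chebyshev
polynomial `T_n`. -/
noncomputable def ultraC (d n : ℕ) (x : ℝ) : ℝ :=
  if d = 1 then chebyshevT n x
  else gegenbauerC (((d : ℝ) - 1) / 2) n x / gegenbauerC (((d : ℝ) - 1) / 2) n 1

/-- Dimension `N_n(d)` of the space of spherical harmonics of degree `n` on `S^d`. -/
noncomputable def NNdim (n d : ℕ) : ℝ :=
  if n = 0 then 1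
  else (ascPochhammer ℝ (n - 1)).eval (d : ℝ) * (2 * n + d - 1) / Nat.factorial n

/-- Total surface measure `σ_d = 2 π^((d+1)/2) / Γ((d+1)/2)` of the sphere `S^d`
(for `d = 0` this gives the value `2`). -/
noncomputable def sigmaS (d : ℕ) : ℝ :=
  2 * Real.pi ^ (((d : ℝ) + 1) / 2) / Real.Gamma (((d : ℝ) + 1) / 2)

/-- The class `𝒫(G)` of continuous positive definite functions on a topological group `G`. -/
def IsPosDefOnGroup {G : Type*} [Group G] [TopologicalSpace G] (φ : G → ℂ) : Prop :=
  Continuous φ ∧ ∀ (n : ℕ) (u : Fin n → G) (a : Fin n → ℂ),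
    0 ≤ ∑ k, ∑ l, φ ((u k)⁻¹ * u l) * a k * (starRingEnd ℂ) (a l)

/-- The class `𝒫(S^d, G)`: continuous functions `f` on `[-1,1] × G` such that the kernel
`((ξ,u),(η,v)) ↦ f(ξ·η, u⁻¹v)` is positive definite on `(S^d × G)²`, where `S^d` is the
unit sphere of `ℝ^(d+1)`. -/
def IsPosDefSphereGroup (d : ℕ) {G : Type*} [Group G] [TopologicalSpace G]
    (f : ℝ → G → ℂ) : Prop :=
  ContinuousOn (fun p : ℝ × G => f p.1 p.2) (Set.Icc (-1 : ℝ) 1 ×ˢ Set.univ) ∧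
  ∀ (n : ℕ) (ξ : Fin n → EuclideanSpace ℝ (Fin (d + 1))) (u : Fin n → G),
    (∀ k, ‖ξ k‖ = 1) → ∀ a : Fin n → ℂ,
      0 ≤ ∑ k, ∑ l, f ⟪ξ k, ξ l⟫ ((u k)⁻¹ * u l) * a k * (starRingEnd ℂ) (a l)

/-- The `n`-th `d`-Schoenberg function of `f`:
`φ_{n,d}(u) = (N_n(d) σ_{d-1} / σ_d) ∫_{-1}^1 f(x,u) c_n(d,x) (1-x²)^{d/2-1} dx`. -/
noncomputable def schoenbergFn (d : ℕ) {G : Type*} [Group G] [TopologicalSpace G]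
    (f : ℝ → G → ℂ) (n : ℕ) (u : G) : ℂ :=
  ((NNdim n d * sigmaS (d - 1) / sigmaS d : ℝ) : ℂ) *
    ∫ x in (-1 : ℝ)..1, f x u * ((ultraC d n x : ℝ) : ℂ) *
      (((1 - x ^ 2) ^ ((d : ℝ) / 2 - 1) : ℝ) : ℂ)

/-- The class `𝒫(S^d, S^{d'})`: continuous `f : [-1,1]² → ℝ` such that the kernel
`((ξ,ζ),(η,χ)) ↦ f(ξ·η, ζ·χ)` is positive definite on `(S^d × S^{d'})²`. -/
def IsPosDefTwoSpheres (d d' : ℕ) (f : ℝ → ℝ → ℝ) : Prop :=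
  ContinuousOn (fun p : ℝ × ℝ => f p.1 p.2) (Set.Icc (-1 : ℝ) 1 ×ˢ Set.Icc (-1 : ℝ) 1) ∧
  ∀ (n : ℕ) (ξ : Fin n → EuclideanSpace ℝ (Fin (d + 1)))
    (ζ : Fin n → EuclideanSpace ℝ (Fin (d' + 1))),
    (∀ k, ‖ξ k‖ = 1) → (∀ k, ‖ζ k‖ = 1) → ∀ a : Fin n → ℝ,
      0 ≤ ∑ k, ∑ l, f ⟪ξ k, ξ l⟫ ⟪ζ k, ζ l⟫ * a k * a l

/-- The coefficient `f̂_{n,m}` of Theorem 6.1 in Berg–Porcu. -/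
noncomputable def twoSphereCoef (d d' : ℕ) (f : ℝ → ℝ → ℝ) (n m : ℕ) : ℝ :=
  (NNdim n d * sigmaS (d - 1) / sigmaS d) * (NNdim m d' * sigmaS (d' - 1) / sigmaS d') *
    ∫ x in (-1 : ℝ)..1, ∫ y in (-1 : ℝ)..1,
      f x y * ultraC d n x * ultraC d' m y *
        (1 - x ^ 2) ^ ((d : ℝ) / 2 - 1) * (1 - y ^ 2) ^ ((d' : ℝ) / 2 - 1)

/-! ### The recurrence of the normalized ultraspherical polynomials -/

/-- The normalized ultraspherical polynomials, defined by their three-term recurrence. -/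
noncomputable def zonalPoly (d : ℕ) : ℕ → ℝ[X]
  | 0 => 1
  | 1 => X
  | n + 2 => C ((n + d : ℝ)⁻¹) *
      (C (2 * n + d + 1 : ℝ) * X * zonalPoly d (n + 1) - C (n + 1 : ℝ) * zonalPoly d n)

lemma zonalPoly_zero (d : ℕ) : zonalPoly d 0 = 1 := by rw [zonalPoly]

lemma zonalPoly_one (d : ℕ) : zonalPoly d 1 = X := by rw [zonalPoly]

lemma zonalPoly_rec {d : ℕ} (hd : 1 ≤ d) (n : ℕ) :
    C (n + d : ℝ) * zonalPoly d (n + 2) =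
      C (2 * n + d + 1 : ℝ) * X * zonalPoly d (n + 1) - C (n + 1 : ℝ) * zonalPoly d n := by
  have h : (n + d : ℝ) ≠ 0 := by positivity
  rw [zonalPoly, ← mul_assoc, ← C_mul, mul_inv_cancel₀ h, C_1, one_mul]

lemma zonalPoly_eval_rec {d : ℕ} (hd : 1 ≤ d) (n : ℕ) (x : ℝ) :
    (n + d : ℝ) * (zonalPoly d (n + 2)).eval x =
      (2 * n + d + 1) * x * (zonalPoly d (n + 1)).eval x - (n + 1) * (zonalPoly d n).eval x := by
  simpa using congrArg (eval x) (zonalPoly_rec hd n)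

lemma zonalPoly_eval_one {d : ℕ} (hd : 1 ≤ d) (n : ℕ) : (zonalPoly d n).eval 1 = 1 := by
  induction n using Nat.twoStepInduction with
  | zero => simp [zonalPoly_zero]
  | one => simp [zonalPoly_one]
  | more n h0 h1 =>
    have h := zonalPoly_eval_rec hd n 1
    rw [h0, h1] at h
    have hn : (n + d : ℝ) ≠ 0 := by positivity
    apply mul_left_cancel₀ hn
    linarith

/-- One term of the explicit Gegenbauer sum, extended by zero outside its range. -/
noncomputable def gegenbauerTerm (lam : ℝ) (n k : ℕ) (x : ℝ) : ℝ :=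
  if 2 * k ≤ n then
    (-1 : ℝ) ^ k * ((ascPochhammer ℝ (n - k)).eval lam /
      ((Nat.factorial k : ℝ) * (Nat.factorial (n - 2 * k) : ℝ))) * (2 * x) ^ (n - 2 * k)
  else 0

lemma gegenbauerC_eq_sum_term (lam : ℝ) (n N : ℕ) (hN : n / 2 + 1 ≤ N) (x : ℝ) :
    gegenbauerC lam n x = ∑ k ∈ Finset.range N, gegenbauerTerm lam n k x := by
  rw [gegenbauerC, ← Finset.sum_subset (Finset.range_mono hN)]
  · refine Finset.sum_congr rfl fun k hk => ?_
    have : 2 * k ≤ n := by have := Finset.mem_range.1 hk; omega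
    simp [gegenbauerTerm, this]
  · intro k _ hk
    have : ¬ 2 * k ≤ n := by simp only [Finset.mem_range] at hk; omega
    simp [gegenbauerTerm, this]

lemma gegenbauerTerm_rec_zero (lam : ℝ) (n : ℕ) (x : ℝ) :
    (n + 2 : ℝ) * gegenbauerTerm lam (n + 2) 0 x =
      2 * (n + 1 + lam) * x * gegenbauerTerm lam (n + 1) 0 x := by
  simp only [gegenbauerTerm, mul_zero, Nat.zero_le, if_true, pow_zero, Nat.sub_zero,
    Nat.factorial_zero, Nat.factorial_succ, ascPochhammer_succ_eval]
  push_cast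
  field_simp
  ring

lemma gegenbauerTerm_rec_succ (lam : ℝ) (n k : ℕ) (hk : 2 * k ≤ n) (x : ℝ) :
    (n + 2 : ℝ) * gegenbauerTerm lam (n + 2) (k + 1) x =
      2 * (n + 1 + lam) * x * gegenbauerTerm lam (n + 1) (k + 1) x
        - (n + 2 * lam) * gegenbauerTerm lam n k x := by
  obtain ⟨j, rfl⟩ := Nat.exists_eq_add_of_le hk
  have e1 : 2 * k + j + 2 - (k + 1) = k + j + 1 := by omega
  have e2 : 2 * k + j + 2 - 2 * (k + 1) = j := by omega
  have e3 : 2 * k + j + 1 - (k + 1) = k + j := by omega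
  have e4 : 2 * k + j - k = k + j := by omega
  have e5 : 2 * k + j - 2 * k = j := by omega
  have h1 : 2 * (k + 1) ≤ 2 * k + j + 2 := by omega
  simp only [gegenbauerTerm, e1, e2, e3, e4, e5, if_pos hk, if_pos h1, ascPochhammer_succ_eval,
    Nat.factorial_succ, pow_succ (-1 : ℝ) k]
  rcases j with _ | j
  · have h2 : ¬ 2 * (k + 1) ≤ 2 * k + 0 + 1 := by omega
    rw [if_neg h2]
    push_cast
    field_simp
    ring
  · have h2 : 2 * (k + 1) ≤ 2 * k + (j + 1) + 1 := by omega
    have e6 : 2 * k + (j + 1) + 1 - 2 * (k + 1) = j := by omega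
    rw [if_pos h2, e6]
    simp only [Nat.factorial_succ, pow_succ]
    push_cast
    field_simp
    ring

lemma gegenbauerC_rec (lam : ℝ) (n : ℕ) (x : ℝ) :
    (n + 2 : ℝ) * gegenbauerC lam (n + 2) x =
      2 * (n + 1 + lam) * x * gegenbauerC lam (n + 1) x - (n + 2 * lam) * gegenbauerC lam n x := by
  rw [gegenbauerC_eq_sum_term lam (n + 2) (n / 2 + 1 + 1) (by omega),
    gegenbauerC_eq_sum_term lam (n + 1) (n / 2 + 1 + 1) (by omega),
    gegenbauerC_eq_sum_term lam n (n / 2 + 1) le_rfl,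
    Finset.sum_range_succ' _ (n / 2 + 1), Finset.sum_range_succ' _ (n / 2 + 1), mul_add, mul_add, Finset.mul_sum,
    Finset.mul_sum, Finset.mul_sum, gegenbauerTerm_rec_zero, add_sub_right_comm,
    ← Finset.sum_sub_distrib]
  congr 1
  refine Finset.sum_congr rfl fun k hk => gegenbauerTerm_rec_succ _ _ _ ?_ _
  have := Finset.mem_range.1 hk
  omega

lemma gegenbauerC_eq_zonalPoly {d : ℕ} (hd : 1 ≤ d) (n : ℕ) (x : ℝ) :
    gegenbauerC (((d : ℝ) - 1) / 2) n x =
      (ascPochhammer ℝ n).eval ((d : ℝ) - 1) / (Nat.factorial n : ℝ) *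
        (zonalPoly d n).eval x := by
  induction n using Nat.twoStepInduction with
  | zero => simp [gegenbauerC, zonalPoly_zero]
  | one =>
    simp [gegenbauerC, zonalPoly_one]
    ring
  | more n h0 h1 =>
    have h := gegenbauerC_rec (((d : ℝ) - 1) / 2) n x
    rw [h0, h1] at h
    have hz := zonalPoly_eval_rec hd n x
    have hn : (n + 2 : ℝ) ≠ 0 := by positivity
    apply mul_left_cancel₀ hn
    rw [h]
    simp only [ascPochhammer_succ_eval, Nat.factorial_succ]
    push_cast
    have : ((n : ℝ) + 1) ≠ 0 := by positivity
    field_simp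
    linear_combination (-(Polynomial.eval ((d : ℝ) - 1) (ascPochhammer ℝ n)) *
      ((d : ℝ) - 1 + n) * (n + 2)) * hz

lemma chebyshevT_eq_zonalPoly (n : ℕ) (x : ℝ) : chebyshevT n x = (zonalPoly 1 n).eval x := by
  induction n using Nat.twoStepInduction with
  | zero => simp [chebyshevT, zonalPoly_zero]
  | one => simp [chebyshevT, zonalPoly_one]
  | more n h0 h1 =>
    have hz := zonalPoly_eval_rec le_rfl n x
    rw [← h0, ← h1] at hz
    have hn : ((n : ℝ) + (1 : ℕ)) ≠ 0 := by positivity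
    apply mul_left_cancel₀ hn
    rw [hz]
    simp only [chebyshevT]
    push_cast
    rw [Polynomial.Chebyshev.T_add_two]
    simp
    ring

lemma ultraC_eq_zonalPoly {d : ℕ} (hd : 1 ≤ d) (n : ℕ) (x : ℝ) :
    ultraC d n x = (zonalPoly d n).eval x := by
  by_cases h : d = 1
  · subst h
    simp [ultraC, chebyshevT_eq_zonalPoly]
  · have hd2 : (0 : ℝ) < (d : ℝ) - 1 := by
      have : (1 : ℝ) < d := by exact_mod_cast (by omega : 1 < d)
      linarith
    have hp : (ascPochhammer ℝ n).eval ((d : ℝ) - 1) / (Nat.factorial n : ℝ) ≠ 0 :=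
      (div_pos (ascPochhammer_pos n _ hd2) (by positivity)).ne'
    rw [ultraC, if_neg h, gegenbauerC_eq_zonalPoly hd, gegenbauerC_eq_zonalPoly hd,
      zonalPoly_eval_one hd, mul_one, mul_div_cancel_left₀ _ hp]

/-! ### The differential equation -/

lemma zonalPoly_derivative {d : ℕ} (hd : 1 ≤ d) (n : ℕ) :
    (1 - X ^ 2) * derivative (zonalPoly d (n + 1)) =
        C (n + 1 : ℝ) * (zonalPoly d n - X * zonalPoly d (n + 1)) ∧
      (1 - X ^ 2) * derivative (zonalPoly d n) =
        C (n + d - 1 : ℝ) * (X * zonalPoly d n - zonalPoly d (n + 1)) := by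
  induction n with
  | zero =>
    simp only [zonalPoly_zero, zonalPoly_one, zero_add]
    simp
    ring
  | succ n ih =>
    obtain ⟨hA, hB⟩ := ih
    have hr := zonalPoly_rec hd n
    have hdr := congrArg derivative hr
    simp only [derivative_mul, derivative_C, derivative_X, derivative_sub, zero_mul, zero_add,
      mul_one] at hdr
    have hn : C (n + d : ℝ) ≠ 0 := by
      rw [Ne, C_eq_zero]
      positivity
    have h2 : (C (2 : ℝ) : ℝ[X]) = 2 := map_ofNat C 2
    simp only [C_add, C_sub, C_mul, C_1, h2] at hA hB hr hdr hn ⊢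
    have hB' : (1 - X ^ 2) * derivative (zonalPoly d (n + 1)) =
        (C (n : ℝ) + C (d : ℝ)) * (X * zonalPoly d (n + 1) - zonalPoly d (n + 2)) := by
      rw [hA]
      linear_combination hr
    constructor
    · apply mul_left_cancel₀ hn
      push_cast
      simp only [C_add, C_1]
      linear_combination (1 - X ^ 2) * hdr + (2 * C (n : ℝ) + C (d : ℝ) + 1) * X * hB'
        - (C (n : ℝ) + 1) * hB - (C (n : ℝ) + C (d : ℝ) - 1) * X * hr
    · push_cast
      simp only [C_add, C_1]
      rw [hB']
      ring

lemma zonalPoly_ode {d : ℕ} (hd : 1 ≤ d) (n : ℕ) :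
    (1 - X ^ 2) * derivative (derivative (zonalPoly d n)) =
      C (d : ℝ) * X * derivative (zonalPoly d n) - C (n * (n + d - 1) : ℝ) * zonalPoly d n := by
  rcases n with _ | n
  · simp [zonalPoly_zero]
  · obtain ⟨hA, hB⟩ := zonalPoly_derivative hd n
    have hdA := congrArg derivative hA
    have h1 : (1 - X ^ 2 : ℝ[X]) ≠ 0 := by
      intro h
      simpa using congrArg (eval 0) h
    simp only [derivative_mul, derivative_C, derivative_X, derivative_sub, zero_mul, zero_add,
      one_mul, derivative_one, derivative_X_pow, zero_sub] at hdA
    push_cast at hdA ⊢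
    have h2 : (C (2 : ℝ) : ℝ[X]) = 2 := map_ofNat C 2
    simp only [C_add, C_sub, C_mul, C_1, h2] at hA hB hdA ⊢
    apply mul_left_cancel₀ h1
    linear_combination (1 - X ^ 2) * hdA + (C (n : ℝ) + 1) * hB
      + (2 * X - (C (n : ℝ) + 1) * X - C (d : ℝ) * X) * hA

/-- Every polynomial is a linear combination of the normalized ultraspherical polynomials. -/
lemma mem_span_zonalPoly {d : ℕ} (hd : 1 ≤ d) (q : ℝ[X]) :
    q ∈ Submodule.span ℝ (Set.range (zonalPoly d)) := by
  have hX : ∀ r ∈ Submodule.span ℝ (Set.range (zonalPoly d)),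
      r * X ∈ Submodule.span ℝ (Set.range (zonalPoly d)) := by
    intro r hr
    induction hr using Submodule.span_induction with
    | mem r hr =>
      obtain ⟨n, rfl⟩ := hr
      rcases n with _ | n
      · rw [zonalPoly_zero, one_mul, ← zonalPoly_one d]
        exact Submodule.subset_span ⟨1, rfl⟩
      · have h : zonalPoly d (n + 1) * X =
            ((n + d : ℝ) / (2 * n + d + 1)) • zonalPoly d (n + 2) +
              ((n + 1 : ℝ) / (2 * n + d + 1)) • zonalPoly d n := by
          have hn : (2 * n + d + 1 : ℝ) ≠ 0 := by positivity
          apply Polynomial.funext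
          intro x
          have := zonalPoly_eval_rec hd n x
          simp only [eval_mul, eval_X, eval_add, eval_smul, smul_eq_mul]
          field_simp
          linarith
        rw [h]
        exact add_mem (Submodule.smul_mem _ _ (Submodule.subset_span ⟨_, rfl⟩))
          (Submodule.smul_mem _ _ (Submodule.subset_span ⟨_, rfl⟩))
    | zero => simp
    | add a b _ _ ha hb => rw [add_mul]; exact add_mem ha hb
    | smul c a _ ha => rw [smul_mul_assoc]; exact Submodule.smul_mem _ _ ha
  induction q using Polynomial.induction_on' with
  | add p q hp hq => exact add_mem hp hq
  | monomial n a =>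
    rw [← C_mul_X_pow_eq_monomial, ← smul_eq_C_mul]
    refine Submodule.smul_mem _ _ ?_
    induction n with
    | zero => rw [pow_zero, ← zonalPoly_zero d]; exact Submodule.subset_span ⟨0, rfl⟩
    | succ n ih => rw [pow_succ]; exact hX _ ih
/-! ### Zonal harmonics and the Fischer inner product -/

section Fischer

variable {ι : Type*} [Fintype ι]

/-- The linear form `x ↦ ∑ i, η i * x i`. -/
noncomputable def linForm (η : ι → ℝ) : MvPolynomial ι ℝ :=
  ∑ i, MvPolynomial.C (η i) * MvPolynomial.X i

/-- The squared Euclidean norm as a polynomial. -/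
noncomputable def normSqPoly (ι : Type*) [Fintype ι] : MvPolynomial ι ℝ :=
  ∑ i, MvPolynomial.X i ^ 2

/-- The directional derivative along `η`. -/
noncomputable def dirDeriv (η : ι → ℝ) (p : MvPolynomial ι ℝ) : MvPolynomial ι ℝ :=
  ∑ i, MvPolynomial.C (η i) * MvPolynomial.pderiv i p

/-- The Laplace operator on polynomials. -/
noncomputable def lap (p : MvPolynomial ι ℝ) : MvPolynomial ι ℝ :=
  ∑ i, MvPolynomial.pderiv i (MvPolynomial.pderiv i p)

lemma dirDeriv_mul (η : ι → ℝ) (p q : MvPolynomial ι ℝ) :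
    dirDeriv η (p * q) = dirDeriv η p * q + p * dirDeriv η q := by
  simp only [dirDeriv, MvPolynomial.pderiv_mul, Finset.sum_mul, Finset.mul_sum,
    ← Finset.sum_add_distrib]
  exact Finset.sum_congr rfl fun _ _ => by ring

lemma dirDeriv_sub (η : ι → ℝ) (p q : MvPolynomial ι ℝ) :
    dirDeriv η (p - q) = dirDeriv η p - dirDeriv η q := by
  simp only [dirDeriv, map_sub, mul_sub, Finset.sum_sub_distrib]

lemma dirDeriv_C (η : ι → ℝ) (a : ℝ) : dirDeriv η (MvPolynomial.C a) = 0 := by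
  simp [dirDeriv]

lemma pderiv_linForm (η : ι → ℝ) (i : ι) :
    MvPolynomial.pderiv i (linForm η) = MvPolynomial.C (η i) := by
  classical
  simp [linForm, MvPolynomial.pderiv_X, Pi.single_apply]

lemma pderiv_normSqPoly (i : ι) :
    MvPolynomial.pderiv i (normSqPoly ι) = 2 * MvPolynomial.X i := by
  classical
  simp [normSqPoly, MvPolynomial.pderiv_X, Pi.single_apply, Derivation.leibniz_pow, two_mul]

lemma dirDeriv_linForm (η : ι → ℝ) (hη : ∑ i, η i ^ 2 = 1) : dirDeriv η (linForm η) = 1 := by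
  simp only [dirDeriv, pderiv_linForm, ← sq]
  simp only [← map_pow, ← map_sum, hη, MvPolynomial.C_1]

lemma dirDeriv_normSqPoly (η : ι → ℝ) :
    dirDeriv η (normSqPoly ι) = 2 * linForm η := by
  simp only [dirDeriv, pderiv_normSqPoly, linForm, Finset.mul_sum]
  exact Finset.sum_congr rfl fun _ _ => by ring

lemma lap_sub (p q : MvPolynomial ι ℝ) : lap (p - q) = lap p - lap q := by
  simp only [lap, map_sub, Finset.sum_sub_distrib]

lemma lap_C_mul (a : ℝ) (p : MvPolynomial ι ℝ) :
    lap (MvPolynomial.C a * p) = MvPolynomial.C a * lap p := by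
  simp only [lap, MvPolynomial.pderiv_C_mul, Finset.mul_sum]

lemma lap_linForm_mul (η : ι → ℝ) (p : MvPolynomial ι ℝ) :
    lap (linForm η * p) = 2 * dirDeriv η p + linForm η * lap p := by
  simp only [lap, dirDeriv, MvPolynomial.pderiv_mul, pderiv_linForm, map_add, Finset.mul_sum,
    ← Finset.sum_add_distrib, MvPolynomial.pderiv_C]
  exact Finset.sum_congr rfl fun _ _ => by ring

lemma lap_normSqPoly_mul {p : MvPolynomial ι ℝ} {n : ℕ} (hp : p.IsHomogeneous n) :
    lap (normSqPoly ι * p) =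
      MvPolynomial.C (2 * Fintype.card ι + 4 * n : ℝ) * p + normSqPoly ι * lap p := by
  have h : ∀ i : ι, MvPolynomial.pderiv i (MvPolynomial.pderiv i (normSqPoly ι * p)) =
      2 * p + 4 * (MvPolynomial.X i * MvPolynomial.pderiv i p) +
        normSqPoly ι * MvPolynomial.pderiv i (MvPolynomial.pderiv i p) := by
    intro i
    have h2 : MvPolynomial.pderiv i (2 : MvPolynomial ι ℝ) = 0 := by
      rw [← map_ofNat (MvPolynomial.C (σ := ι) (R := ℝ)) 2, MvPolynomial.pderiv_C]
    simp only [MvPolynomial.pderiv_mul, pderiv_normSqPoly, map_add, MvPolynomial.pderiv_X_self, h2]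
    ring
  simp only [lap, h, Finset.sum_add_distrib, ← Finset.mul_sum, hp.sum_X_mul_pderiv]
  simp only [Finset.sum_const, Finset.card_univ, nsmul_eq_mul, map_add, map_mul, map_natCast,
    map_ofNat]
  ring

/-- The Fischer inner product of two polynomials. -/
noncomputable def fischer (p q : MvPolynomial ι ℝ) : ℝ :=
  (MvPolynomial.basisMonomials ι ℝ).constr ℝ
    (fun α => (∏ i, (Nat.factorial (α i) : ℝ)) * MvPolynomial.coeff α q) p

lemma fischer_add_left (p p' q : MvPolynomial ι ℝ) :
    fischer (p + p') q = fischer p q + fischer p' q := map_add _ _ _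

lemma fischer_sum_left {κ : Type*} (s : Finset κ) (p : κ → MvPolynomial ι ℝ)
    (q : MvPolynomial ι ℝ) : fischer (∑ k ∈ s, p k) q = ∑ k ∈ s, fischer (p k) q :=
  map_sum _ _ _

lemma fischer_C_mul_left (c : ℝ) (p q : MvPolynomial ι ℝ) :
    fischer (MvPolynomial.C c * p) q = c * fischer p q := by
  rw [MvPolynomial.C_mul', fischer, map_smul, smul_eq_mul, fischer]

lemma fischer_monomial_left (α : ι →₀ ℕ) (a : ℝ) (q : MvPolynomial ι ℝ) :
    fischer (MvPolynomial.monomial α a) q =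
      a * ((∏ i, (Nat.factorial (α i) : ℝ)) * MvPolynomial.coeff α q) := by
  have : MvPolynomial.monomial α a =
      MvPolynomial.C a * MvPolynomial.basisMonomials ι ℝ α := by
    rw [MvPolynomial.coe_basisMonomials, MvPolynomial.C_mul_monomial, mul_one]
  rw [this, fischer_C_mul_left, fischer, Module.Basis.constr_basis]

lemma fischer_eq_sum (p q : MvPolynomial ι ℝ) (s : Finset (ι →₀ ℕ)) (hs : p.support ⊆ s) :
    fischer p q = ∑ α ∈ s, (∏ i, (Nat.factorial (α i) : ℝ)) *
      (MvPolynomial.coeff α p * MvPolynomial.coeff α q) := by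
  conv_lhs => rw [p.as_sum, fischer_sum_left]
  rw [← Finset.sum_subset hs]
  · refine Finset.sum_congr rfl fun α _ => ?_
    rw [fischer_monomial_left]
    ring
  · intro α _ hα
    rw [MvPolynomial.notMem_support_iff.1 hα]
    ring

lemma fischer_add_right (p q q' : MvPolynomial ι ℝ) :
    fischer p (q + q') = fischer p q + fischer p q' := by
  simp only [fischer_eq_sum p _ _ subset_rfl, MvPolynomial.coeff_add, mul_add,
    Finset.sum_add_distrib]

lemma fischer_zero_right (p : MvPolynomial ι ℝ) : fischer p 0 = 0 := by
  simp [fischer_eq_sum p _ _ subset_rfl]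

lemma fischer_sum_right {κ : Type*} (s : Finset κ) (p : MvPolynomial ι ℝ)
    (q : κ → MvPolynomial ι ℝ) : fischer p (∑ k ∈ s, q k) = ∑ k ∈ s, fischer p (q k) :=
  map_sum (AddMonoidHom.mk' (fischer p) (fischer_add_right p)) q s

lemma fischer_C_mul_right (c : ℝ) (p q : MvPolynomial ι ℝ) :
    fischer p (MvPolynomial.C c * q) = c * fischer p q := by
  simp only [fischer_eq_sum p _ _ subset_rfl, MvPolynomial.coeff_C_mul, Finset.mul_sum]
  exact Finset.sum_congr rfl fun _ _ => by ring

/-- Multiplication by a variable is adjoint to the partial derivative. -/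
lemma fischer_X_mul (i : ι) (p q : MvPolynomial ι ℝ) :
    fischer (MvPolynomial.X i * p) q = fischer p (MvPolynomial.pderiv i q) := by
  classical
  induction p using MvPolynomial.induction_on' with
  | add p p' hp hp' => rw [mul_add, fischer_add_left, fischer_add_left, hp, hp']
  | monomial α a =>
    have hX : MvPolynomial.X i * MvPolynomial.monomial α a =
        MvPolynomial.monomial (α + Finsupp.single i 1) a := by
      rw [MvPolynomial.X, MvPolynomial.monomial_mul, one_mul, add_comm]
    rw [hX, fischer_monomial_left, fischer_monomial_left, MvPolynomial.coeff_pderiv]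
    have hf : ∏ j, (Nat.factorial ((α + Finsupp.single i 1 : ι →₀ ℕ) j) : ℝ) =
        (α i + 1) * ∏ j, (Nat.factorial (α j) : ℝ) := by
      rw [← Finset.mul_prod_erase _ _ (Finset.mem_univ i),
        ← Finset.mul_prod_erase _ (fun j => (Nat.factorial (α j) : ℝ)) (Finset.mem_univ i),
        ← mul_assoc]
      congr 1
      · simp [Nat.factorial_succ]
      · refine Finset.prod_congr rfl fun j hj => ?_
        have : i ≠ j := (Finset.ne_of_mem_erase hj).symm
        simp [this]
    rw [hf]
    ring

lemma fischer_linForm_mul (ξ : ι → ℝ) (p q : MvPolynomial ι ℝ) :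
    fischer (linForm ξ * p) q = fischer p (dirDeriv ξ q) := by
  simp only [linForm, dirDeriv, Finset.sum_mul, fischer_sum_left, fischer_sum_right, mul_assoc,
    fischer_C_mul_left, fischer_C_mul_right, fischer_X_mul]

lemma fischer_normSqPoly_mul (p q : MvPolynomial ι ℝ) :
    fischer (normSqPoly ι * p) q = fischer p (lap q) := by
  simp only [normSqPoly, lap, Finset.sum_mul, fischer_sum_left, fischer_sum_right, sq, mul_assoc,
    fischer_X_mul]

/-- Pairing with a power of a linear form is evaluation. -/
lemma fischer_linForm_pow (ξ : ι → ℝ) {n : ℕ} {q : MvPolynomial ι ℝ} (hq : q.IsHomogeneous n) :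
    fischer (linForm ξ ^ n) q = Nat.factorial n * MvPolynomial.eval ξ q := by
  induction n generalizing q with
  | zero =>
    obtain ⟨a, rfl⟩ : ∃ a, q = MvPolynomial.C a :=
      ⟨_, MvPolynomial.totalDegree_eq_zero_iff_eq_C.1
        (Nat.le_zero.1 hq.totalDegree_le)⟩
    have h1 : (1 : MvPolynomial ι ℝ) = MvPolynomial.monomial 0 1 := rfl
    rw [pow_zero, h1, fischer_monomial_left]
    simp
  | succ n ih =>
    have hd : (dirDeriv ξ q).IsHomogeneous n := by
      refine MvPolynomial.IsHomogeneous.sum _ _ _ fun i _ => ?_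
      have := (MvPolynomial.isHomogeneous_C ι (ξ i)).mul (hq.pderiv (i := i))
      simpa using this
    have he : MvPolynomial.eval ξ (dirDeriv ξ q) = (n + 1) * MvPolynomial.eval ξ q := by
      have := congrArg (MvPolynomial.eval ξ) hq.sum_X_mul_pderiv
      simpa [dirDeriv] using this
    rw [pow_succ', fischer_linForm_mul, ih hd, he, Nat.factorial_succ]
    push_cast
    ring

/-- The zonal harmonic of degree `n` with pole `η`, in dimension `d + 1`. -/
noncomputable def zonalHarm (d : ℕ) (η : ι → ℝ) : ℕ → MvPolynomial ι ℝ
  | 0 => 1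
  | 1 => linForm η
  | n + 2 => MvPolynomial.C ((n + d : ℝ)⁻¹) *
      (MvPolynomial.C (2 * n + d + 1 : ℝ) * (linForm η * zonalHarm d η (n + 1)) -
        MvPolynomial.C (n + 1 : ℝ) * (normSqPoly ι * zonalHarm d η n))

lemma zonalHarm_zero (d : ℕ) (η : ι → ℝ) : zonalHarm d η 0 = 1 := by rw [zonalHarm]

lemma zonalHarm_one (d : ℕ) (η : ι → ℝ) : zonalHarm d η 1 = linForm η := by rw [zonalHarm]

lemma zonalHarm_rec {d : ℕ} (hd : 1 ≤ d) (η : ι → ℝ) (n : ℕ) :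
    MvPolynomial.C (n + d : ℝ) * zonalHarm d η (n + 2) =
      MvPolynomial.C (2 * n + d + 1 : ℝ) * (linForm η * zonalHarm d η (n + 1)) -
        MvPolynomial.C (n + 1 : ℝ) * (normSqPoly ι * zonalHarm d η n) := by
  have h : (n + d : ℝ) ≠ 0 := by positivity
  rw [zonalHarm, ← mul_assoc, ← MvPolynomial.C_mul, mul_inv_cancel₀ h, MvPolynomial.C_1, one_mul]

lemma isHomogeneous_linForm (η : ι → ℝ) : (linForm η).IsHomogeneous 1 := by
  refine MvPolynomial.IsHomogeneous.sum _ _ _ fun i _ => ?_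
  simpa using (MvPolynomial.isHomogeneous_C ι (η i)).mul (MvPolynomial.isHomogeneous_X ℝ i)

lemma isHomogeneous_normSqPoly : (normSqPoly ι).IsHomogeneous 2 := by
  refine MvPolynomial.IsHomogeneous.sum _ _ _ fun i _ => ?_
  simpa using (MvPolynomial.isHomogeneous_X ℝ i).pow 2

lemma isHomogeneous_zonalHarm (d : ℕ) (η : ι → ℝ) (n : ℕ) :
    (zonalHarm d η n).IsHomogeneous n := by
  induction n using Nat.twoStepInduction with
  | zero => rw [zonalHarm_zero]; exact MvPolynomial.isHomogeneous_one _ _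
  | one => rw [zonalHarm_one]; exact isHomogeneous_linForm η
  | more n h0 h1 =>
    have hC : ∀ (a : ℝ) {q : MvPolynomial ι ℝ} {m : ℕ}, q.IsHomogeneous m →
        (MvPolynomial.C a * q).IsHomogeneous m := fun a q m hq => by
      simpa using (MvPolynomial.isHomogeneous_C ι a).mul hq
    rw [zonalHarm]
    refine hC _ (MvPolynomial.IsHomogeneous.sub (hC _ ?_) (hC _ ?_))
    · have := (isHomogeneous_linForm η).mul h1
      rwa [show 1 + (n + 1) = n + 2 by ring] at this
    · simpa [add_comm] using isHomogeneous_normSqPoly.mul h0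

lemma dirDeriv_zonalHarm {d : ℕ} (hd : 1 ≤ d) (η : ι → ℝ) (hη : ∑ i, η i ^ 2 = 1) (n : ℕ) :
    dirDeriv η (zonalHarm d η (n + 1)) = MvPolynomial.C (n + 1 : ℝ) * zonalHarm d η n := by
  induction n using Nat.twoStepInduction with
  | zero => simp [zonalHarm_zero, zonalHarm_one, dirDeriv_linForm η hη]
  | one =>
    have hr := congrArg (dirDeriv η) (zonalHarm_rec hd η 0)
    have hn : MvPolynomial.C (d : ℝ) ≠ (0 : MvPolynomial ι ℝ) := by
      rw [Ne, MvPolynomial.C_eq_zero]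
      positivity
    simp only [dirDeriv_C, zero_mul, zero_add, dirDeriv_sub, dirDeriv_mul, dirDeriv_linForm η hη,
      dirDeriv_normSqPoly, zonalHarm_zero, zonalHarm_one] at hr ⊢
    apply mul_left_cancel₀ hn
    have h1 : dirDeriv η (1 : MvPolynomial ι ℝ) = 0 := dirDeriv_C η 1
    simp only [CharP.cast_eq_zero, h1, map_add, map_mul, map_natCast, map_ofNat, map_one,
      map_zero] at hr ⊢
    push_cast at hr ⊢
    linear_combination hr
  | more n h0 h1 =>
    have hr := congrArg (dirDeriv η) (zonalHarm_rec hd η (n + 1))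
    have hr0 := zonalHarm_rec hd η n
    have hn : MvPolynomial.C (n + 1 + d : ℝ) ≠ (0 : MvPolynomial ι ℝ) := by
      rw [Ne, MvPolynomial.C_eq_zero]
      positivity
    apply mul_left_cancel₀ hn
    simp only [dirDeriv_C, zero_mul, zero_add, dirDeriv_sub, dirDeriv_mul, dirDeriv_linForm η hη,
      dirDeriv_normSqPoly, h0, h1] at hr ⊢
    push_cast at hr ⊢
    simp only [map_add, map_mul, map_natCast, map_ofNat, map_one] at hr hr0 ⊢
    linear_combination hr - (n + 2 : MvPolynomial ι ℝ) * hr0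

lemma lap_zonalHarm {d : ℕ} (hd : 1 ≤ d) (hι : Fintype.card ι = d + 1) (η : ι → ℝ)
    (hη : ∑ i, η i ^ 2 = 1) (n : ℕ) : lap (zonalHarm d η n) = 0 := by
  induction n using Nat.twoStepInduction with
  | zero => simp [zonalHarm_zero, lap]
  | one => simp [zonalHarm_one, lap, pderiv_linForm]
  | more n h0 h1 =>
    have hn : MvPolynomial.C (n + d : ℝ) ≠ (0 : MvPolynomial ι ℝ) := by
      rw [Ne, MvPolynomial.C_eq_zero]
      positivity
    apply mul_left_cancel₀ hn
    have hr := congrArg lap (zonalHarm_rec hd η n)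
    simp only [lap_C_mul, lap_sub, lap_linForm_mul, dirDeriv_zonalHarm hd η hη,
      lap_normSqPoly_mul (isHomogeneous_zonalHarm d η n), h0, h1, hι] at hr
    rw [hr]
    push_cast
    simp only [map_add, map_mul, map_natCast, map_ofNat, map_one]
    ring

lemma exists_zonalHarm_eq {d : ℕ} (hd : 1 ≤ d) (n : ℕ) :
    ∃ a : ℝ, 0 < a ∧ ∀ η : ι → ℝ, ∃ r : MvPolynomial ι ℝ,
      zonalHarm d η n = MvPolynomial.C a * linForm η ^ n + normSqPoly ι * r := by
  induction n using Nat.twoStepInduction with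
  | zero => exact ⟨1, one_pos, fun η => ⟨0, by simp [zonalHarm_zero]⟩⟩
  | one => exact ⟨1, one_pos, fun η => ⟨0, by simp [zonalHarm_one]⟩⟩
  | more n h0 h1 =>
    obtain ⟨a, ha, hr⟩ := h1
    refine ⟨(n + d : ℝ)⁻¹ * ((2 * n + d + 1) * a), by positivity, fun η => ?_⟩
    obtain ⟨r, hr⟩ := hr η
    refine ⟨MvPolynomial.C ((n + d : ℝ)⁻¹) * (MvPolynomial.C (2 * n + d + 1 : ℝ) *
      (linForm η * r) - MvPolynomial.C (n + 1 : ℝ) * zonalHarm d η n), ?_⟩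
    rw [zonalHarm, hr, MvPolynomial.C_mul, MvPolynomial.C_mul]
    ring

lemma eval_zonalHarm {d : ℕ} (η ξ : ι → ℝ) (hξ : ∑ i, ξ i ^ 2 = 1) (n : ℕ) :
    MvPolynomial.eval ξ (zonalHarm d η n) = (zonalPoly d n).eval (∑ i, η i * ξ i) := by
  induction n using Nat.twoStepInduction with
  | zero => simp [zonalHarm_zero, zonalPoly_zero]
  | one => simp [zonalHarm_one, zonalPoly_one, linForm]
  | more n h0 h1 =>
    rw [zonalHarm, zonalPoly]
    simp only [map_mul, map_sub, MvPolynomial.eval_C, h0, h1, normSqPoly, linForm, map_sum,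
      map_pow, MvPolynomial.eval_X, hξ, eval_mul, eval_sub, eval_C, eval_X]
    ring

end Fischer

lemma sum_sq_eq_one {d : ℕ} {ξ : EuclideanSpace ℝ (Fin (d + 1))} (hξ : ‖ξ‖ = 1) :
    ∑ i, ξ i ^ 2 = 1 := by
  have := EuclideanSpace.real_norm_sq_eq ξ
  rw [hξ] at this
  linarith

/-- The zonal kernels are Gram kernels: a finite-dimensional form of the addition theorem. -/
lemma exists_zonalPoly_inner_eq {d : ℕ} (hd : 1 ≤ d) (n : ℕ) {κ : Type*} [Fintype κ]
    (ξ : κ → EuclideanSpace ℝ (Fin (d + 1))) (hξ : ∀ k, ‖ξ k‖ = 1) :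
    ∃ (s : Finset (Fin (d + 1) →₀ ℕ)) (u : κ → (Fin (d + 1) →₀ ℕ) → ℝ),
      ∀ k l, (zonalPoly d n).eval ⟪ξ k, ξ l⟫ = ∑ α ∈ s, u k α * u l α := by
  classical
  obtain ⟨a, ha, hr⟩ := exists_zonalHarm_eq (ι := Fin (d + 1)) hd n
  let Z : κ → MvPolynomial (Fin (d + 1)) ℝ := fun k => zonalHarm d (ξ k) n
  let w : (Fin (d + 1) →₀ ℕ) → ℝ := fun α =>
    (∏ i, (Nat.factorial (α i) : ℝ)) / (a * Nat.factorial n)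
  refine ⟨Finset.univ.biUnion fun k => (Z k).support,
    fun k α => Real.sqrt (w α) * (Z k).coeff α, fun k l => ?_⟩
  have h1 : fischer (Z k) (Z l) =
      a * Nat.factorial n * (zonalPoly d n).eval ⟪ξ k, ξ l⟫ := by
    obtain ⟨r, hr⟩ := hr (ξ k)
    have hl : lap (Z l) = 0 := lap_zonalHarm hd (by simp) _ (sum_sq_eq_one (hξ l)) n
    have hk : Z k = _ := hr
    rw [hk, fischer_add_left, fischer_normSqPoly_mul, hl, fischer_zero_right,
      fischer_C_mul_left, fischer_linForm_pow _ (isHomogeneous_zonalHarm d _ n),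
      eval_zonalHarm _ _ (sum_sq_eq_one (hξ k))]
    simp only [PiLp.inner_apply, RCLike.inner_apply, conj_trivial]
    ring
  rw [fischer_eq_sum (Z k) (Z l) _
    (Finset.subset_biUnion_of_mem (fun k => (Z k).support) (Finset.mem_univ k))] at h1
  have h2 : a * (Nat.factorial n : ℝ) ≠ 0 := by positivity
  rw [eq_comm, mul_comm, ← eq_div_iff h2] at h1
  rw [h1, Finset.sum_div]
  refine Finset.sum_congr rfl fun α _ => ?_
  have hw : Real.sqrt (w α) * Real.sqrt (w α) = w α := Real.mul_self_sqrt (by positivity)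
  calc _ = w α * (MvPolynomial.coeff α (Z k) * MvPolynomial.coeff α (Z l)) := by
        simp only [w]; ring
    _ = _ := by rw [← hw]; ring
/-! ### The ultraspherical weight -/

/-- The ultraspherical weight `(1 - x²)^(d/2 - 1)`. -/
noncomputable def ultraWeight (d : ℕ) (x : ℝ) : ℝ := (1 - x ^ 2) ^ ((d : ℝ) / 2 - 1)

lemma measurable_ultraWeight (d : ℕ) : Measurable (ultraWeight d) := by
  unfold ultraWeight
  fun_prop

lemma one_sub_sq_pos {x : ℝ} (hx : x ∈ Set.Ioo (-1 : ℝ) 1) : 0 < 1 - x ^ 2 := by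
  nlinarith [hx.1, hx.2]

lemma one_sub_sq_nonneg {x : ℝ} (hx : x ∈ Set.Icc (-1 : ℝ) 1) : 0 ≤ 1 - x ^ 2 := by
  nlinarith [hx.1, hx.2]

lemma ultraWeight_one {x : ℝ} (hx : x ∈ Set.Icc (-1 : ℝ) 1) :
    ultraWeight 1 x = 1 / Real.sqrt (1 - x ^ 2) := by
  have h := one_sub_sq_nonneg hx
  rw [ultraWeight, Real.sqrt_eq_rpow, one_div, ← Real.rpow_neg h]
  norm_num

lemma intervalIntegrable_ultraWeight {d : ℕ} (hd : 1 ≤ d) :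
    IntervalIntegrable (ultraWeight d) volume (-1) 1 := by
  rcases eq_or_lt_of_le hd with rfl | hd
  · have h : IntervalIntegrable (fun x : ℝ => 1 / Real.sqrt (1 - x ^ 2)) volume (-1) 1 := by
      apply intervalIntegral.intervalIntegrable_deriv_of_nonneg (g := Real.arcsin)
      · exact Real.continuous_arcsin.continuousOn
      · intro x hx
        norm_num at hx
        exact Real.hasDerivAt_arcsin (by linarith [hx.1]) (by linarith [hx.2])
      · intro x _
        positivity
    refine h.congr fun x hx => (ultraWeight_one ?_).symm
    rw [Set.uIoc_of_le (by norm_num)] at hx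
    exact ⟨hx.1.le, hx.2⟩
  · apply Continuous.intervalIntegrable
    refine Continuous.rpow_const (by fun_prop) fun x => Or.inr ?_
    have : (2 : ℝ) ≤ d := by exact_mod_cast hd
    linarith

/-- The interval `[-1, 1]` as a compact space. -/
abbrev UnitIcc : Type := Set.Icc (-1 : ℝ) 1

/-- The measure on `[-1, 1]` with density `(1 - x²)^(d/2 - 1)`. -/
noncomputable def ultraMeasure (d : ℕ) : Measure UnitIcc :=
  ((volume : Measure ℝ).comap ((↑) : UnitIcc → ℝ)).withDensity fun x => ENNReal.ofReal (ultraWeight d (x : ℝ))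

lemma integral_ultraMeasure (d : ℕ) (g : ℝ → ℝ) :
    ∫ x : UnitIcc, g x ∂(ultraMeasure d) = ∫ x in (-1 : ℝ)..1, g x * ultraWeight d x := by
  rw [ultraMeasure, integral_withDensity_eq_integral_toReal_smul, intervalIntegral.integral_of_le
    (by norm_num), ← integral_Icc_eq_integral_Ioc]
  · rw [← integral_subtype_comap measurableSet_Icc (fun x => g x * ultraWeight d x)]
    refine integral_congr_ae (ae_of_all _ fun x => ?_)
    have : 0 ≤ ultraWeight d x := Real.rpow_nonneg (one_sub_sq_nonneg x.2) _
    simp only [ENNReal.toReal_ofReal this, smul_eq_mul, mul_comm]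
  · exact ((measurable_ultraWeight d).comp measurable_subtype_coe).ennreal_ofReal
  · exact ae_of_all _ fun x => ENNReal.ofReal_lt_top

lemma isFiniteMeasure_ultraMeasure {d : ℕ} (hd : 1 ≤ d) : IsFiniteMeasure (ultraMeasure d) := by
  apply isFiniteMeasure_withDensity_ofReal
  have h := intervalIntegrable_ultraWeight hd
  rw [intervalIntegrable_iff_integrableOn_Icc_of_le (by norm_num)] at h
  have := (MeasurableEmbedding.subtype_coe measurableSet_Icc).integrable_map_iff
    (μ := (volume : Measure ℝ).comap ((↑) : UnitIcc → ℝ)) (g := ultraWeight d)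
  rw [map_comap_subtype_coe measurableSet_Icc] at this
  exact (this.1 h).2

lemma isOpenPosMeasure_ultraMeasure (d : ℕ) : (ultraMeasure d).IsOpenPosMeasure := by
  refine ⟨fun U hU hne h0 => ?_⟩
  obtain ⟨V, hV, rfl⟩ := isOpen_induced_iff.1 hU
  obtain ⟨⟨x, hx⟩, hxV⟩ := hne
  have hm : Measurable fun x : UnitIcc => ENNReal.ofReal (ultraWeight d x) :=
    ((measurable_ultraWeight d).comp measurable_subtype_coe).ennreal_ofReal
  have hne : (V ∩ Set.Ioo (-1 : ℝ) 1).Nonempty := by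
    have : x ∈ closure (Set.Ioo (-1 : ℝ) 1) := by rwa [closure_Ioo (by norm_num)]
    exact mem_closure_iff.1 this V hV hxV
  have hpos := (hV.inter isOpen_Ioo).measure_pos volume hne
  rw [ultraMeasure, withDensity_apply_eq_zero hm] at h0
  refine hpos.ne' ?_
  rw [comap_subtype_coe_apply measurableSet_Icc] at h0
  refine measure_mono_null (fun y hy => ?_) h0
  refine ⟨⟨y, hy.2.1.le, hy.2.2.le⟩, ⟨?_, hy.1⟩, rfl⟩
  have : 0 < ultraWeight d y := Real.rpow_pos_of_pos (one_sub_sq_pos hy.2) _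
  simpa using this

lemma integrable_ultraMeasure {d : ℕ} (hd : 1 ≤ d) {g : UnitIcc → ℝ} (hg : Continuous g) :
    Integrable g (ultraMeasure d) := by
  have := isFiniteMeasure_ultraMeasure hd
  exact hg.integrable_of_hasCompactSupport (HasCompactSupport.of_compactSpace g)

/-! ### Orthogonality -/

/-- Integration of polynomials against the ultraspherical weight. -/
noncomputable def ultraFunctional (d : ℕ) (q : ℝ[X]) : ℝ :=
  ∫ x : UnitIcc, q.eval (x : ℝ) ∂(ultraMeasure d)

lemma continuous_eval_coe (q : ℝ[X]) : Continuous fun x : UnitIcc => q.eval (x : ℝ) :=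
  q.continuous.comp continuous_subtype_val

lemma ultraFunctional_C_mul (d : ℕ) (a : ℝ) (q : ℝ[X]) :
    ultraFunctional d (C a * q) = a * ultraFunctional d q := by
  simp only [ultraFunctional, eval_mul, eval_C]
  exact integral_const_mul _ _

lemma ultraFunctional_sub {d : ℕ} (hd : 1 ≤ d) (p q : ℝ[X]) :
    ultraFunctional d (p - q) = ultraFunctional d p - ultraFunctional d q := by
  simp only [ultraFunctional, eval_sub]
  exact integral_sub (integrable_ultraMeasure hd (continuous_eval_coe p))
    (integrable_ultraMeasure hd (continuous_eval_coe q))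

/-- Integration by parts against the ultraspherical weight. -/
lemma ultraFunctional_parts {d : ℕ} (hd : 1 ≤ d) (q : ℝ[X]) :
    ultraFunctional d ((1 - X ^ 2) * derivative q - C (d : ℝ) * X * q) = 0 := by
  have hd0 : (0 : ℝ) < (d : ℝ) / 2 := by positivity
  rw [ultraFunctional, integral_ultraMeasure d
    (fun x => ((1 - X ^ 2) * derivative q - C (d : ℝ) * X * q : ℝ[X]).eval x)]
  rw [intervalIntegral.integral_eq_sub_of_hasDerivAt_of_le (by norm_num)
    (f := fun x => (1 - x ^ 2) ^ ((d : ℝ) / 2) * q.eval x)]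
  · norm_num [Real.zero_rpow hd0.ne']
  · exact ((Continuous.rpow_const (by fun_prop) fun x => Or.inr hd0.le).mul
      q.continuous).continuousOn
  · intro x hx
    have hp := one_sub_sq_pos hx
    have h1 : HasDerivAt (fun x : ℝ => 1 - x ^ 2) (-(2 * x)) x := by
      simpa using (hasDerivAt_pow 2 x).const_sub 1
    have h2 := (h1.rpow_const (p := (d : ℝ) / 2) (Or.inl hp.ne')).mul (q.hasDerivAt x)
    refine HasDerivAt.congr_deriv h2 ?_
    have h3 : (1 - x ^ 2) ^ ((d : ℝ) / 2) = (1 - x ^ 2) * ultraWeight d x := by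
      rw [ultraWeight, ← Real.rpow_one_add' hp.le]
      · congr 1; ring
      · simpa using hd0.ne'
    rw [h3, ← ultraWeight]
    simp only [eval_sub, eval_mul, eval_C, eval_X, eval_one, eval_pow]
    ring
  · exact (intervalIntegrable_ultraWeight hd).continuousOn_mul (Polynomial.continuous _).continuousOn

lemma ultraFunctional_zonalPoly_mul_of_ne {d : ℕ} (hd : 1 ≤ d) {n m : ℕ} (hnm : n ≠ m) :
    ultraFunctional d (zonalPoly d n * zonalPoly d m) = 0 := by
  have h := ultraFunctional_parts hd (zonalPoly d n * derivative (zonalPoly d m) -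
    derivative (zonalPoly d n) * zonalPoly d m)
  have hn := zonalPoly_ode hd n
  have hm := zonalPoly_ode hd m
  have e : (1 - X ^ 2) * derivative (zonalPoly d n * derivative (zonalPoly d m) -
      derivative (zonalPoly d n) * zonalPoly d m) - C (d : ℝ) * X *
      (zonalPoly d n * derivative (zonalPoly d m) - derivative (zonalPoly d n) * zonalPoly d m) =
      C (n * (n + d - 1) - m * (m + d - 1) : ℝ) * (zonalPoly d n * zonalPoly d m) := by
    simp only [derivative_sub, derivative_mul]
    rw [C_sub]
    linear_combination zonalPoly d n * hm - zonalPoly d m * hn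
  rw [e, ultraFunctional_C_mul] at h
  refine (mul_eq_zero.1 h).resolve_left fun h0 => ?_
  have h1 : ((n : ℝ) - m) * (n + m + d - 1) = 0 := by linear_combination h0
  rcases mul_eq_zero.1 h1 with h2 | h2
  · exact hnm (by exact_mod_cast sub_eq_zero.1 h2)
  · have h3 : n + m + d = 1 := by exact_mod_cast sub_eq_zero.1 h2
    omega

lemma ultraFunctional_zonalPoly_sq_succ {d : ℕ} (hd : 1 ≤ d) (n : ℕ) :
    (n + d : ℝ) * (2 * n + d + 3) *
        ultraFunctional d (zonalPoly d (n + 2) * zonalPoly d (n + 2)) =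
      (2 * n + d + 1) * (n + 2) *
        ultraFunctional d (zonalPoly d (n + 1) * zonalPoly d (n + 1)) := by
  have h1 := congrArg (fun q => ultraFunctional d (q * zonalPoly d (n + 2))) (zonalPoly_rec hd n)
  have h2 := congrArg (fun q => ultraFunctional d (q * zonalPoly d (n + 1)))
    (zonalPoly_rec hd (n + 1))
  simp only [sub_mul, ultraFunctional_sub hd, mul_assoc, ultraFunctional_C_mul] at h1 h2
  rw [ultraFunctional_zonalPoly_mul_of_ne hd (by omega : n ≠ n + 2)] at h1
  rw [ultraFunctional_zonalPoly_mul_of_ne hd (by omega : n + 1 + 2 ≠ n + 1),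
    mul_comm (zonalPoly d (n + 1 + 1))] at h2
  push_cast at h1 h2
  linear_combination (2 * n + d + 3 : ℝ) * h1 - (2 * n + d + 1 : ℝ) * h2

lemma ultraFunctional_zonalPoly_sq_one {d : ℕ} (hd : 1 ≤ d) :
    (d + 1 : ℝ) * ultraFunctional d (zonalPoly d 1 * zonalPoly d 1) =
      ultraFunctional d 1 := by
  have h := ultraFunctional_parts hd X
  have e : (1 - X ^ 2) * derivative X - C (d : ℝ) * X * X = 1 - C (d + 1 : ℝ) * (X * X) := by
    simp
    ring
  rw [e, ultraFunctional_sub hd, ultraFunctional_C_mul] at h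
  rw [zonalPoly_one]
  linarith

lemma NNdim_pos {d : ℕ} (hd : 1 ≤ d) (n : ℕ) : 0 < NNdim n d := by
  rw [NNdim]
  split_ifs with h
  · exact one_pos
  · have h1 : (0 : ℝ) < d := by positivity
    have h2 : (1 : ℝ) ≤ n := by exact_mod_cast Nat.one_le_iff_ne_zero.2 h
    have := ascPochhammer_pos (n - 1) _ h1
    have h3 : (0 : ℝ) < 2 * n + d - 1 := by linarith
    positivity

lemma NNdim_mul_ultraFunctional_sq {d : ℕ} (hd : 1 ≤ d) (n : ℕ) :
    NNdim n d * ultraFunctional d (zonalPoly d n * zonalPoly d n) = ultraFunctional d 1 := by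
  rcases n with _ | n
  · simp [NNdim, zonalPoly_zero]
  induction n with
  | zero =>
    rw [← ultraFunctional_zonalPoly_sq_one hd]
    simp [NNdim]
    ring_nf
    simp
  | succ n ih =>
    have h := ultraFunctional_zonalPoly_sq_succ hd n
    have h3 : (2 * n + d + 3 : ℝ) ≠ 0 := by positivity
    have h4 : (n + d : ℝ) ≠ 0 := by positivity
    have h5 : (2 * n + d + 1 : ℝ) ≠ 0 := by positivity
    rw [← ih]
    simp only [NNdim, Nat.succ_ne_zero, if_false, Nat.add_sub_cancel, Nat.factorial_succ,
      ascPochhammer_succ_eval]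
    push_cast
    field_simp
    linear_combination (Polynomial.eval (d : ℝ) (ascPochhammer ℝ n)) * h

lemma ultraFunctional_one_add_two {d : ℕ} (hd : 1 ≤ d) :
    (d + 1 : ℝ) * ultraFunctional (d + 2) 1 = d * ultraFunctional d 1 := by
  have h : ultraFunctional (d + 2) 1 = ultraFunctional d (1 - X * X) := by
    rw [ultraFunctional, ultraFunctional,
      integral_ultraMeasure _ (fun x => (1 : ℝ[X]).eval x),
      integral_ultraMeasure _ (fun x => (1 - X * X : ℝ[X]).eval x)]
    apply intervalIntegral.integral_congr_ae
    refine ae_of_all _ fun x hx => ?_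
    rw [Set.uIoc_of_le (by norm_num)] at hx
    have hd0 : (0 : ℝ) < (d : ℝ) / 2 := by positivity
    have hp := one_sub_sq_nonneg ⟨hx.1.le, hx.2⟩
    simp only [ultraWeight, eval_one, eval_sub, eval_mul, eval_X, one_mul]
    rw [← sq, ← Real.rpow_one_add' hp]
    · congr 1; push_cast; ring
    · simpa using hd0.ne'
  have h1 := ultraFunctional_zonalPoly_sq_one hd
  rw [zonalPoly_one] at h1
  rw [h, ultraFunctional_sub hd]
  linarith

lemma ultraFunctional_one_one : ultraFunctional 1 1 = Real.pi := by
  rw [ultraFunctional, integral_ultraMeasure 1 (fun x => (1 : ℝ[X]).eval x)]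
  rw [intervalIntegral.integral_eq_sub_of_hasDerivAt_of_le (by norm_num) (f := Real.arcsin)]
  · simp
  · exact Real.continuous_arcsin.continuousOn
  · intro x hx
    rw [eval_one, one_mul, ultraWeight_one ⟨hx.1.le, hx.2.le⟩]
    exact Real.hasDerivAt_arcsin (by linarith [hx.1]) (by linarith [hx.2])
  · simpa using intervalIntegrable_ultraWeight le_rfl

lemma ultraFunctional_two_one : ultraFunctional 2 1 = 2 := by
  rw [ultraFunctional, integral_ultraMeasure 2 (fun x => (1 : ℝ[X]).eval x)]
  simp [ultraWeight]
  norm_num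

lemma sigmaS_pos (d : ℕ) : 0 < sigmaS d := by
  have := Real.Gamma_pos_of_pos (by positivity : (0 : ℝ) < ((d : ℝ) + 1) / 2)
  unfold sigmaS
  positivity

lemma sigmaS_add_two (d : ℕ) : (d + 1 : ℝ) * sigmaS (d + 2) = 2 * Real.pi * sigmaS d := by
  have h0 : (((d : ℝ) + 1) / 2) ≠ 0 := by positivity
  have hG := (Real.Gamma_pos_of_pos (by positivity : (0 : ℝ) < ((d : ℝ) + 1) / 2)).ne'
  have e : (((d + 2 : ℕ) : ℝ) + 1) / 2 = ((d : ℝ) + 1) / 2 + 1 := by push_cast; ring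
  rw [sigmaS, sigmaS, e, Real.Gamma_add_one h0, Real.rpow_add_one Real.pi_pos.ne']
  field_simp

/-- The total mass of the ultraspherical weight. -/
lemma ultraFunctional_one {d : ℕ} (hd : 1 ≤ d) :
    ultraFunctional d 1 * sigmaS (d - 1) = sigmaS d := by
  obtain ⟨d, rfl⟩ := Nat.exists_eq_add_of_le' hd
  clear hd
  rw [Nat.add_sub_cancel]
  have hpi := Real.pi_pos
  have hs := Real.sq_sqrt hpi.le
  induction d using Nat.twoStepInduction with
  | zero =>
    rw [zero_add, ultraFunctional_one_one]
    simp only [sigmaS]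
    have : Real.sqrt Real.pi ≠ 0 := (Real.sqrt_pos.2 hpi).ne'
    norm_num [Real.Gamma_one_half_eq, ← Real.sqrt_eq_rpow]
    field_simp
  | one =>
    rw [ultraFunctional_two_one]
    have h32 : Real.Gamma (3 / 2) = 1 / 2 * Real.sqrt Real.pi := by
      rw [show (3 / 2 : ℝ) = 1 / 2 + 1 by norm_num, Real.Gamma_add_one (by norm_num),
        Real.Gamma_one_half_eq]
    have hp : Real.pi ^ (3 / 2 : ℝ) = Real.pi * Real.sqrt Real.pi := by
      rw [show (3 / 2 : ℝ) = 1 + 1 / 2 by norm_num, Real.rpow_add hpi, Real.rpow_one,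
        Real.sqrt_eq_rpow]
    have : Real.sqrt Real.pi ≠ 0 := (Real.sqrt_pos.2 hpi).ne'
    simp only [sigmaS]
    norm_num [h32, hp]
    field_simp
  | more n h0 h1 =>
    have h2 := ultraFunctional_one_add_two (d := n + 1) (by omega)
    have h3 := sigmaS_add_two n
    have h4 := sigmaS_add_two (n + 1)
    have e : n + 2 + 1 = n + 1 + 2 := by ring
    rw [e]
    push_cast at h2 h4
    have h5 : ((n : ℝ) + 1 + 1) ≠ 0 := by positivity
    have h6 : ((n : ℝ) + 1) ≠ 0 := by positivity
    apply mul_left_cancel₀ h5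
    apply mul_left_cancel₀ h6
    linear_combination (n + 1 : ℝ) * sigmaS (n + 2) * h2
      + (n + 1 : ℝ) * ultraFunctional (n + 1) 1 * h3 + (2 * Real.pi * (n + 1 : ℝ)) * h0
      - (n + 1 : ℝ) * h4

/-! ### Gaussian integrals of polynomials -/

section Gaussian

variable {d : ℕ}

/-- The Gaussian weight `exp (-‖x‖² / 2)`. -/
noncomputable def gaussWeight (x : EuclideanSpace ℝ (Fin (d + 1))) : ℝ :=
  Real.exp (-(‖x‖ ^ 2) / 2)

lemma continuous_eval_ofLp (p : MvPolynomial (Fin (d + 1)) ℝ) :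
    Continuous fun x : EuclideanSpace ℝ (Fin (d + 1)) => MvPolynomial.eval x.ofLp p :=
  (MvPolynomial.continuous_eval p).comp (PiLp.continuous_ofLp 2 _)

lemma continuous_gaussWeight : Continuous (gaussWeight (d := d)) := by
  unfold gaussWeight
  fun_prop

lemma integrable_norm_pow_mul_gaussWeight (k : ℕ) :
    Integrable fun x : EuclideanSpace ℝ (Fin (d + 1)) => ‖x‖ ^ k * gaussWeight x := by
  refine (integrable_fun_norm_addHaar volume
    (f := fun r : ℝ => r ^ k * Real.exp (-(r ^ 2) / 2))).2 ?_
  refine ((integrable_rpow_mul_exp_neg_mul_sq (b := 1 / 2) (by norm_num)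
    (s := ((d + k : ℕ) : ℝ)) (by
      have : (0 : ℝ) ≤ ((d + k : ℕ) : ℝ) := Nat.cast_nonneg _
      linarith)).integrableOn).congr_fun (fun r _ => ?_) measurableSet_Ioi
  simp only [Real.rpow_natCast, finrank_euclideanSpace, Fintype.card_fin, Nat.add_sub_cancel,
    smul_eq_mul, pow_add, mul_assoc]
  congr 3
  ring_nf

lemma integrable_norm_pow_mul_eval (p : MvPolynomial (Fin (d + 1)) ℝ) (k : ℕ) :
    Integrable fun x : EuclideanSpace ℝ (Fin (d + 1)) =>
      ‖x‖ ^ k * MvPolynomial.eval x.ofLp p * gaussWeight x := by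
  induction p using MvPolynomial.induction_on generalizing k with
  | C a =>
    refine ((integrable_norm_pow_mul_gaussWeight k).const_mul a).congr (ae_of_all _ fun x => ?_)
    simp only [MvPolynomial.eval_C]
    ring
  | add p q hp hq =>
    refine ((hp k).add (hq k)).congr (ae_of_all _ fun x => ?_)
    simp only [Pi.add_apply, map_add]
    ring
  | mul_X p i hp =>
    refine (hp (k + 1)).mono ?_ (ae_of_all _ fun x => ?_)
    · have := continuous_eval_ofLp (p * MvPolynomial.X i)
      have := continuous_gaussWeight (d := d)
      exact Continuous.aestronglyMeasurable (by fun_prop)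
    · simp only [norm_mul, norm_pow, norm_norm, map_mul, MvPolynomial.eval_X, pow_succ]
      have h := PiLp.norm_apply_le x i
      have : ‖x‖ ^ k * (‖MvPolynomial.eval x.ofLp p‖ * ‖x.ofLp i‖) * ‖gaussWeight x‖ =
          ‖x‖ ^ k * ‖x.ofLp i‖ * ‖MvPolynomial.eval x.ofLp p‖ * ‖gaussWeight x‖ := by ring
      rw [this]
      gcongr

lemma integrable_eval_mul_gaussWeight (p : MvPolynomial (Fin (d + 1)) ℝ) :
    Integrable fun x : EuclideanSpace ℝ (Fin (d + 1)) =>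
      MvPolynomial.eval x.ofLp p * gaussWeight x := by
  simpa using integrable_norm_pow_mul_eval p 0

/-- The integral of a polynomial against the Gaussian weight. -/
noncomputable def gaussFunctional (p : MvPolynomial (Fin (d + 1)) ℝ) : ℝ :=
  ∫ x : EuclideanSpace ℝ (Fin (d + 1)), MvPolynomial.eval x.ofLp p * gaussWeight x

lemma gaussFunctional_C_mul (a : ℝ) (p : MvPolynomial (Fin (d + 1)) ℝ) :
    gaussFunctional (MvPolynomial.C a * p) = a * gaussFunctional p := by
  simp only [gaussFunctional, map_mul, MvPolynomial.eval_C, mul_assoc]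
  exact integral_const_mul _ _

lemma gaussFunctional_sub (p q : MvPolynomial (Fin (d + 1)) ℝ) :
    gaussFunctional (p - q) = gaussFunctional p - gaussFunctional q := by
  simp only [gaussFunctional, map_sub, sub_mul]
  exact integral_sub (integrable_eval_mul_gaussWeight p) (integrable_eval_mul_gaussWeight q)

lemma gaussFunctional_sum {α : Type*} (s : Finset α) (p : α → MvPolynomial (Fin (d + 1)) ℝ) :
    gaussFunctional (∑ a ∈ s, p a) = ∑ a ∈ s, gaussFunctional (p a) := by
  simp only [gaussFunctional, map_sum, Finset.sum_mul]
  exact integral_finsetSum _ fun a _ => integrable_eval_mul_gaussWeight (p a)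

lemma hasLineDerivAt_eval (p : MvPolynomial (Fin (d + 1)) ℝ)
    (x v : EuclideanSpace ℝ (Fin (d + 1))) :
    HasLineDerivAt ℝ (fun x : EuclideanSpace ℝ (Fin (d + 1)) => MvPolynomial.eval x.ofLp p)
      (MvPolynomial.eval x.ofLp (dirDeriv v.ofLp p)) x v := by
  unfold HasLineDerivAt
  induction p using MvPolynomial.induction_on with
  | C a => simpa [dirDeriv_C] using hasDerivAt_const (0 : ℝ) a
  | add p q hp hq =>
    have : dirDeriv v.ofLp (p + q) = dirDeriv v.ofLp p + dirDeriv v.ofLp q := by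
      simp only [dirDeriv, map_add, mul_add, Finset.sum_add_distrib]
    rw [this]
    simp only [map_add]
    exact hp.add hq
  | mul_X p i hp =>
    have hX : dirDeriv v.ofLp (MvPolynomial.X i) = MvPolynomial.C (v.ofLp i) := by
      classical
      simp [dirDeriv, MvPolynomial.pderiv_X, Pi.single_apply]
    have h1 : HasDerivAt (fun t : ℝ => x.ofLp i + t * v.ofLp i) (v.ofLp i) 0 := by
      simpa using ((hasDerivAt_id (0 : ℝ)).mul_const (v.ofLp i)).const_add (x.ofLp i)
    rw [dirDeriv_mul, hX]
    simp only [map_mul, map_add, MvPolynomial.eval_X, MvPolynomial.eval_C]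
    refine (hp.mul h1).congr_deriv ?_
    simp

lemma hasLineDerivAt_gaussWeight (x v : EuclideanSpace ℝ (Fin (d + 1))) :
    HasLineDerivAt ℝ gaussWeight
      (-(MvPolynomial.eval x.ofLp (linForm v.ofLp) * gaussWeight x)) x v := by
  unfold HasLineDerivAt
  have h0 : HasDerivAt (fun t : ℝ => x + t • v) v 0 := by
    simpa using ((hasDerivAt_id (0 : ℝ)).smul_const v).const_add x
  have h1 := ((h0.norm_sq.neg).div_const 2).exp
  refine h1.congr_deriv ?_
  have : ⟪x, v⟫ = MvPolynomial.eval x.ofLp (linForm v.ofLp) := by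
    simp [linForm, PiLp.inner_apply]
  simp only [zero_smul, add_zero, this, gaussWeight]
  simp
  ring

/-- Gaussian integration by parts. -/
lemma gaussFunctional_linForm_mul (η : Fin (d + 1) → ℝ) (p : MvPolynomial (Fin (d + 1)) ℝ) :
    gaussFunctional (linForm η * p) = gaussFunctional (dirDeriv η p) := by
  have h := integral_bilinear_hasLineDerivAt_right_eq_neg_left_of_integrable
    (μ := (volume : Measure (EuclideanSpace ℝ (Fin (d + 1)))))
    (f := fun x : EuclideanSpace ℝ (Fin (d + 1)) => MvPolynomial.eval x.ofLp p)
    (f' := fun x => MvPolynomial.eval x.ofLp (dirDeriv η p))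
    (g := gaussWeight) (g' := fun x => -(MvPolynomial.eval x.ofLp (linForm η) * gaussWeight x))
    (v := WithLp.toLp 2 η) (B := ContinuousLinearMap.mul ℝ ℝ)
    (by simpa using integrable_eval_mul_gaussWeight (dirDeriv η p))
    (by
      refine (integrable_eval_mul_gaussWeight (linForm η * p)).neg.congr (ae_of_all _ fun x => ?_)
      simp only [Pi.neg_apply, map_mul, ContinuousLinearMap.mul_apply']
      ring)
    (by simpa using integrable_eval_mul_gaussWeight p)
    (fun x _ => hasLineDerivAt_eval p x _) (fun x _ => hasLineDerivAt_gaussWeight x _)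
  simp only [ContinuousLinearMap.mul_apply', mul_neg, integral_neg, neg_inj] at h
  rw [gaussFunctional, gaussFunctional, ← h]
  refine integral_congr_ae (ae_of_all _ fun x => ?_)
  simp only [map_mul]
  ring

lemma gaussFunctional_normSqPoly_mul {n : ℕ} {p : MvPolynomial (Fin (d + 1)) ℝ}
    (hp : p.IsHomogeneous n) :
    gaussFunctional (normSqPoly (Fin (d + 1)) * p) = (n + d + 1 : ℝ) * gaussFunctional p := by
  classical
  have hX : ∀ i (q : MvPolynomial (Fin (d + 1)) ℝ),
      gaussFunctional (MvPolynomial.X i * q) = gaussFunctional (MvPolynomial.pderiv i q) := by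
    intro i q
    have := gaussFunctional_linForm_mul (Pi.single i 1) q
    simpa [linForm, dirDeriv, Pi.single_apply, ite_mul, apply_ite] using this
  have e : normSqPoly (Fin (d + 1)) * p =
      ∑ i, MvPolynomial.X i * (MvPolynomial.X i * p) := by
    simp only [normSqPoly, Finset.sum_mul]
    exact Finset.sum_congr rfl fun _ _ => by ring
  have e2 : ∑ i, MvPolynomial.pderiv i (MvPolynomial.X i * p) =
      MvPolynomial.C (n + d + 1 : ℝ) * p := by
    have h := hp.sum_X_mul_pderiv
    simp only [MvPolynomial.pderiv_mul, MvPolynomial.pderiv_X_self, one_mul,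
      Finset.sum_add_distrib, h]
    simp
    ring
  rw [e, gaussFunctional_sum]
  simp only [hX]
  rw [← gaussFunctional_sum, e2, gaussFunctional_C_mul]

lemma gaussFunctional_zonalHarm (hd : 1 ≤ d) (η : Fin (d + 1) → ℝ) (hη : ∑ i, η i ^ 2 = 1)
    (n : ℕ) : gaussFunctional (zonalHarm d η (n + 1)) = 0 := by
  have key : ∀ n : ℕ, (n + d : ℝ) * gaussFunctional (zonalHarm d η (n + 2)) =
      n * (n + 1) * gaussFunctional (zonalHarm d η n) := by
    intro n
    have h := congrArg gaussFunctional (zonalHarm_rec hd η n)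
    rw [gaussFunctional_C_mul, gaussFunctional_sub, gaussFunctional_C_mul, gaussFunctional_C_mul,
      gaussFunctional_linForm_mul, dirDeriv_zonalHarm hd η hη,
      gaussFunctional_normSqPoly_mul (isHomogeneous_zonalHarm d η n), gaussFunctional_C_mul] at h
    linear_combination h
  induction n using Nat.twoStepInduction with
  | zero =>
    rw [zonalHarm_one, ← mul_one (linForm η), gaussFunctional_linForm_mul, ← MvPolynomial.C_1,
      dirDeriv_C]
    simp [gaussFunctional]
  | one =>
    have := key 0
    have h : (d : ℝ) ≠ 0 := by positivity
    simpa [h] using this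
  | more n h0 _ =>
    have := key (n + 1)
    rw [h0, mul_zero] at this
    refine (mul_eq_zero.1 this).resolve_left ?_
    positivity

lemma eval_smul_of_isHomogeneous {ι : Type*} [Fintype ι] {n : ℕ} {q : MvPolynomial ι ℝ}
    (hq : q.IsHomogeneous n) (a : ℝ) (x : ι → ℝ) :
    MvPolynomial.eval (a • x) q = a ^ n * MvPolynomial.eval x q := by
  rw [MvPolynomial.eval_eq', MvPolynomial.eval_eq', Finset.mul_sum]
  refine Finset.sum_congr rfl fun α hα => ?_
  have h : Finsupp.weight (fun _ => 1) α = n := hq (MvPolynomial.mem_support_iff.1 hα)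
  rw [← Finsupp.degree_eq_weight_one, Finsupp.degree_eq_sum] at h
  simp only [Pi.smul_apply, smul_eq_mul, mul_pow, Finset.prod_mul_distrib,
    Finset.prod_pow_eq_pow_sum, h]
  ring

end Gaussian

/-! ### Zonal functions on the sphere -/

section Sphere

/-- The unit sphere `S^d`. -/
abbrev USphere (d : ℕ) : Type := Metric.sphere (0 : EuclideanSpace ℝ (Fin (d + 1))) 1

/-- The surface measure on `S^d`. -/
noncomputable def surfaceMeasure (d : ℕ) : Measure (USphere d) :=
  (volume : Measure (EuclideanSpace ℝ (Fin (d + 1)))).toSphere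

/-- The normalized surface measure on `S^d`. -/
noncomputable def sphereMeasure (d : ℕ) : Measure (USphere d) :=
  (surfaceMeasure d Set.univ)⁻¹ • surfaceMeasure d

instance (d : ℕ) : IsProbabilityMeasure (sphereMeasure d) := by
  have : NeZero (surfaceMeasure d) := ⟨Measure.toSphere_ne_zero _⟩
  have : IsFiniteMeasure (surfaceMeasure d) := by unfold surfaceMeasure; infer_instance
  exact isProbabilityMeasureSMul

variable {d : ℕ}

lemma gaussFunctional_eq_mul {n : ℕ} {q : MvPolynomial (Fin (d + 1)) ℝ} (hq : q.IsHomogeneous n) :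
    gaussFunctional q = (∫ ω, MvPolynomial.eval (ω : EuclideanSpace ℝ (Fin (d + 1))).ofLp q
      ∂(surfaceMeasure d)) *
      ∫ r : Set.Ioi (0 : ℝ), (r : ℝ) ^ n * Real.exp (-((r : ℝ) ^ 2) / 2)
        ∂(Measure.volumeIoiPow d) := by
  have h := (volume : Measure (EuclideanSpace ℝ (Fin (d + 1)))).measurePreserving_homeomorphUnitSphereProd.integral_comp
    (Homeomorph.measurableEmbedding _)
    (fun z => MvPolynomial.eval (z.1 : EuclideanSpace ℝ (Fin (d + 1))).ofLp q *
      ((z.2 : ℝ) ^ n * Real.exp (-((z.2 : ℝ) ^ 2) / 2)))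
  rw [integral_prod_mul (fun ω : USphere d =>
      MvPolynomial.eval (ω : EuclideanSpace ℝ (Fin (d + 1))).ofLp q)
    (fun r : Set.Ioi (0 : ℝ) => (r : ℝ) ^ n * Real.exp (-((r : ℝ) ^ 2) / 2))] at h
  simp only [finrank_euclideanSpace, Fintype.card_fin, Nat.add_sub_cancel] at h
  have hs : MeasurableSet {(0 : EuclideanSpace ℝ (Fin (d + 1)))}ᶜ :=
    isOpen_compl_singleton.measurableSet
  have h2 : ∫ x : EuclideanSpace ℝ (Fin (d + 1)), MvPolynomial.eval x.ofLp q * gaussWeight x =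
      ∫ x : ({0}ᶜ : Set (EuclideanSpace ℝ (Fin (d + 1)))),
        MvPolynomial.eval (x : EuclideanSpace ℝ (Fin (d + 1))).ofLp q *
          gaussWeight (x : EuclideanSpace ℝ (Fin (d + 1))) ∂(volume.comap Subtype.val) := by
    rw [integral_subtype_comap hs (fun x : EuclideanSpace ℝ (Fin (d + 1)) =>
      MvPolynomial.eval x.ofLp q * gaussWeight x), restrict_compl_singleton]
  rw [surfaceMeasure, ← h, gaussFunctional, h2]
  refine integral_congr_ae (ae_of_all _ fun x => ?_)
  have hx : ‖(x : EuclideanSpace ℝ (Fin (d + 1)))‖ ≠ 0 := norm_ne_zero_iff.2 x.2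
  have he : MvPolynomial.eval (x : EuclideanSpace ℝ (Fin (d + 1))).ofLp q =
      ‖(x : EuclideanSpace ℝ (Fin (d + 1)))‖ ^ n * MvPolynomial.eval
        (‖(x : EuclideanSpace ℝ (Fin (d + 1)))‖⁻¹ • (x : EuclideanSpace ℝ (Fin (d + 1)))).ofLp q := by
    rw [WithLp.ofLp_smul, eval_smul_of_isHomogeneous hq, ← mul_assoc, ← mul_pow,
      mul_inv_cancel₀ hx, one_pow, one_mul]
  simp only [homeomorphUnitSphereProd_apply_fst_coe, homeomorphUnitSphereProd_apply_snd_coe,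
    he, gaussWeight]
  ring

lemma surfaceMeasure_integral_zonalHarm (hd : 1 ≤ d) (η : Fin (d + 1) → ℝ)
    (hη : ∑ i, η i ^ 2 = 1) (n : ℕ) :
    ∫ ω, MvPolynomial.eval (ω : EuclideanSpace ℝ (Fin (d + 1))).ofLp (zonalHarm d η (n + 1))
      ∂(surfaceMeasure d) = 0 := by
  have h := gaussFunctional_zonalHarm hd η hη n
  rw [gaussFunctional_eq_mul (isHomogeneous_zonalHarm d η (n + 1))] at h
  refine (mul_eq_zero.1 h).resolve_right fun h0 => ?_
  have h1 := (volume : Measure (EuclideanSpace ℝ (Fin (d + 1)))).measurePreserving_homeomorphUnitSphereProd.integral_comp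
    (Homeomorph.measurableEmbedding _)
    (fun z => (1 : ℝ) * ((z.2 : ℝ) ^ (n + 1) * Real.exp (-((z.2 : ℝ) ^ 2) / 2)))
  rw [integral_prod_mul (fun ω : USphere d => (1 : ℝ))
    (fun r : Set.Ioi (0 : ℝ) => (r : ℝ) ^ (n + 1) * Real.exp (-((r : ℝ) ^ 2) / 2))] at h1
  simp only [finrank_euclideanSpace, Fintype.card_fin, Nat.add_sub_cancel, h0, mul_zero,
    homeomorphUnitSphereProd_apply_snd_coe, one_mul] at h1
  have hs : MeasurableSet {(0 : EuclideanSpace ℝ (Fin (d + 1)))}ᶜ :=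
    isOpen_compl_singleton.measurableSet
  rw [integral_subtype_comap hs
    (fun x : EuclideanSpace ℝ (Fin (d + 1)) => ‖x‖ ^ (n + 1) * Real.exp (-(‖x‖ ^ 2) / 2)),
    restrict_compl_singleton] at h1
  have hpos : 0 < ∫ x : EuclideanSpace ℝ (Fin (d + 1)), ‖x‖ ^ (n + 1) * gaussWeight x := by
    refine integral_pos_of_integrable_nonneg_nonzero
      (x := EuclideanSpace.single (0 : Fin (d + 1)) (1 : ℝ))
      ((by fun_prop : Continuous fun x : EuclideanSpace ℝ (Fin (d + 1)) => ‖x‖ ^ (n + 1)).mul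
        continuous_gaussWeight) (integrable_norm_pow_mul_gaussWeight (n + 1))
      (fun x => mul_nonneg (by positivity) (Real.exp_pos _).le) ?_
    simp [gaussWeight]
  exact hpos.ne' h1

lemma norm_coe_uSphere (ω : USphere d) : ‖(ω : EuclideanSpace ℝ (Fin (d + 1)))‖ = 1 :=
  mem_sphere_zero_iff_norm.1 ω.2

lemma integral_zonalPoly_inner (hd : 1 ≤ d) (η : USphere d) (n : ℕ) :
    ∫ ω : USphere d, (zonalPoly d (n + 1)).eval
      ⟪(ω : EuclideanSpace ℝ (Fin (d + 1))), (η : EuclideanSpace ℝ (Fin (d + 1)))⟫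
      ∂(sphereMeasure d) = 0 := by
  rw [sphereMeasure, integral_smul_measure]
  refine smul_eq_zero_of_right _ (Eq.trans ?_ (surfaceMeasure_integral_zonalHarm hd
    (η : EuclideanSpace ℝ (Fin (d + 1))).ofLp (sum_sq_eq_one (norm_coe_uSphere η)) n))
  refine integral_congr_ae (ae_of_all _ fun ω => ?_)
  simp only
  rw [eval_zonalHarm _ _ (sum_sq_eq_one (norm_coe_uSphere ω))]
  simp [PiLp.inner_apply]

/-- The inner product of two points of the sphere, as an element of `[-1, 1]`. -/
noncomputable def sphereInner (p : USphere d × USphere d) : UnitIcc :=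
  ⟨⟪(p.1 : EuclideanSpace ℝ (Fin (d + 1))), (p.2 : EuclideanSpace ℝ (Fin (d + 1)))⟫, by
    have := abs_real_inner_le_norm (p.1 : EuclideanSpace ℝ (Fin (d + 1)))
      (p.2 : EuclideanSpace ℝ (Fin (d + 1)))
    rw [norm_coe_uSphere, norm_coe_uSphere, one_mul] at this
    exact abs_le.1 this⟩

lemma continuous_sphereInner : Continuous (sphereInner (d := d)) := by
  unfold sphereInner
  fun_prop

/-- The normalized ultraspherical probability measure on `[-1, 1]`. -/
noncomputable def ultraProb (d : ℕ) : Measure UnitIcc :=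
  (ultraMeasure d Set.univ)⁻¹ • ultraMeasure d

lemma ultraMeasure_univ_toReal (d : ℕ) :
    (ultraMeasure d Set.univ).toReal = ultraFunctional d 1 := by
  simp [ultraFunctional, Measure.real]

lemma ultraFunctional_one_pos (hd : 1 ≤ d) : 0 < ultraFunctional d 1 := by
  have := ultraFunctional_one hd
  have h1 := sigmaS_pos d
  have h2 := sigmaS_pos (d - 1)
  rw [← this] at h1
  exact pos_of_mul_pos_left h1 h2.le

lemma isProbabilityMeasure_ultraProb (hd : 1 ≤ d) : IsProbabilityMeasure (ultraProb d) := by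
  have := isFiniteMeasure_ultraMeasure hd
  have : NeZero (ultraMeasure d) := ⟨fun h => by
    have := ultraMeasure_univ_toReal d
    rw [h] at this
    simp only [Measure.coe_zero, Pi.zero_apply, ENNReal.toReal_zero] at this
    exact (ultraFunctional_one_pos hd).ne this⟩
  exact isProbabilityMeasureSMul

lemma integral_ultraProb (d : ℕ) (g : UnitIcc → ℝ) :
    ∫ x, g x ∂(ultraProb d) = (ultraFunctional d 1)⁻¹ * ∫ x, g x ∂(ultraMeasure d) := by
  rw [ultraProb, integral_smul_measure, ENNReal.toReal_inv, ultraMeasure_univ_toReal, smul_eq_mul]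

lemma integrable_ultraProb (hd : 1 ≤ d) {g : UnitIcc → ℝ} (hg : Continuous g) :
    Integrable g (ultraProb d) := by
  have := isProbabilityMeasure_ultraProb hd
  exact hg.integrable_of_hasCompactSupport (HasCompactSupport.of_compactSpace g)

lemma integral_ultraProb_zonalPoly (hd : 1 ≤ d) (n : ℕ) :
    ∫ x : UnitIcc, (zonalPoly d (n + 1)).eval (x : ℝ) ∂(ultraProb d) = 0 := by
  have := ultraFunctional_zonalPoly_mul_of_ne hd (Nat.succ_ne_zero n)
  rw [zonalPoly_zero, mul_one] at this
  rw [integral_ultraProb, ← ultraFunctional, this, mul_zero]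

/-- A measure on `[-1, 1]` is determined by its polynomial moments. -/
lemma integral_eq_of_forall_polynomial {μ ν : Measure UnitIcc} [IsFiniteMeasure μ]
    [IsFiniteMeasure ν]
    (h : ∀ q : ℝ[X], ∫ x : UnitIcc, q.eval (x : ℝ) ∂μ = ∫ x : UnitIcc, q.eval (x : ℝ) ∂ν)
    (g : C(UnitIcc, ℝ)) : ∫ x, g x ∂μ = ∫ x, g x ∂ν := by
  have hle : ∀ ε : ℝ, 0 < ε → |∫ x, g x ∂μ - ∫ x, g x ∂ν| ≤
      (μ.real Set.univ + ν.real Set.univ) * ε := by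
    intro ε hε
    obtain ⟨q, hq⟩ := exists_polynomial_near_continuousMap (-1) 1 g ε hε
    have hb : ∀ x : UnitIcc, ‖q.eval (x : ℝ) - g x‖ ≤ ε := fun x =>
      ((q.toContinuousMapOn _ - g).norm_coe_le_norm x).trans hq.le
    have hi : ∀ (κ : Measure UnitIcc) [IsFiniteMeasure κ],
        |∫ x : UnitIcc, q.eval (x : ℝ) ∂κ - ∫ x, g x ∂κ| ≤ ε * κ.real Set.univ := by
      intro κ _
      rw [← integral_sub]
      · exact norm_integral_le_of_norm_le_const (ae_of_all _ hb)
      · exact (continuous_eval_coe q).integrable_of_hasCompactSupport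
          (HasCompactSupport.of_compactSpace _)
      · exact g.continuous.integrable_of_hasCompactSupport (HasCompactSupport.of_compactSpace _)
    have h1 := abs_le.1 (hi μ)
    have h2 := abs_le.1 (hi ν)
    have h3 := h q
    rw [abs_le]
    constructor <;> nlinarith
  by_contra hne
  have hpos := abs_pos.2 (sub_ne_zero.2 hne)
  set M := μ.real Set.univ + ν.real Set.univ with hM
  have hM0 : 0 ≤ M := add_nonneg measureReal_nonneg measureReal_nonneg
  have := hle (|∫ x, g x ∂μ - ∫ x, g x ∂ν| / (M + 1)) (by positivity)
  rw [mul_div_assoc', le_div_iff₀ (by positivity)] at this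
  nlinarith

lemma map_sphereInner (hd : 1 ≤ d) :
    ((sphereMeasure d).prod (sphereMeasure d)).map sphereInner = ultraProb d := by
  have := isProbabilityMeasure_ultraProb hd
  have hm : Measurable (sphereInner (d := d)) := continuous_sphereInner.measurable
  have := Measure.isProbabilityMeasure_map (μ := (sphereMeasure d).prod (sphereMeasure d))
    hm.aemeasurable
  have hz : ∀ q : ℝ[X], ∫ x : UnitIcc, q.eval (x : ℝ)
      ∂(((sphereMeasure d).prod (sphereMeasure d)).map sphereInner) =
      ∫ x : UnitIcc, q.eval (x : ℝ) ∂(ultraProb d) := by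
    have hint : ∀ (κ : Measure UnitIcc) [IsFiniteMeasure κ] (q : ℝ[X]),
        Integrable (fun x : UnitIcc => q.eval (x : ℝ)) κ := fun κ _ q =>
      (continuous_eval_coe q).integrable_of_hasCompactSupport
        (HasCompactSupport.of_compactSpace _)
    intro q
    induction mem_span_zonalPoly hd q using Submodule.span_induction with
    | mem q hq =>
      obtain ⟨n, rfl⟩ := hq
      rcases n with _ | n
      · simp [zonalPoly_zero]
      · rw [integral_ultraProb_zonalPoly hd, integral_map hm.aemeasurable
          (continuous_eval_coe _).aestronglyMeasurable, integral_prod_symm]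
        · simp only [sphereInner, integral_zonalPoly_inner hd, integral_zero]
        · exact ((continuous_eval_coe _).comp
            continuous_sphereInner).integrable_of_hasCompactSupport
              (HasCompactSupport.of_compactSpace _)
    | zero => simp
    | add p q _ _ hp hq =>
      simp only [eval_add]
      rw [integral_add (hint _ p) (hint _ q), integral_add (hint _ p) (hint _ q), hp, hq]
    | smul a q _ hq =>
      simp only [eval_smul, smul_eq_mul, integral_const_mul, hq]
  exact ext_of_forall_integral_eq_of_IsFiniteMeasure fun g =>
    integral_eq_of_forall_polynomial hz g.toContinuousMap

end Sphere

/-! ### Positive definite kernels on products of spheres -/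

section Positivity

variable {d d' : ℕ}

/-- Positive definiteness on `S^d × S^{d'}` of a zonal kernel. -/
def IsZonalPosDef (d d' : ℕ) (g : UnitIcc × UnitIcc → ℝ) : Prop :=
  ∀ (n : ℕ) (ξ : Fin n → USphere d) (ζ : Fin n → USphere d') (a : Fin n → ℝ),
    0 ≤ ∑ k, ∑ l, g (sphereInner (ξ k, ξ l), sphereInner (ζ k, ζ l)) * a k * a l

/-- Multiplication by a Gram kernel preserves positive semidefinite quadratic forms. -/
lemma quadForm_mul_gram_nonneg {κ σ : Type*} [Fintype κ] {M G : κ → κ → ℝ} {s : Finset σ}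
    {u : κ → σ → ℝ} (hM : ∀ a : κ → ℝ, 0 ≤ ∑ k, ∑ l, M k l * a k * a l)
    (hG : ∀ k l, G k l = ∑ α ∈ s, u k α * u l α) (a : κ → ℝ) :
    0 ≤ ∑ k, ∑ l, M k l * G k l * a k * a l := by
  have : ∑ k, ∑ l, M k l * G k l * a k * a l =
      ∑ α ∈ s, ∑ k, ∑ l, M k l * (u k α * a k) * (u l α * a l) := by
    rw [Finset.sum_comm (s := s)]
    refine Finset.sum_congr rfl fun k _ => ?_
    rw [Finset.sum_comm (s := s)]
    refine Finset.sum_congr rfl fun l _ => ?_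
    rw [hG, Finset.mul_sum, Finset.sum_mul, Finset.sum_mul]
    exact Finset.sum_congr rfl fun α _ => by ring
  rw [this]
  exact Finset.sum_nonneg fun α _ => hM fun k => u k α * a k

lemma IsZonalPosDef.mul_zonalPoly (hd : 1 ≤ d) (hd' : 1 ≤ d') {g : UnitIcc × UnitIcc → ℝ}
    (hg : IsZonalPosDef d d' g) (n m : ℕ) :
    IsZonalPosDef d d' fun z =>
      g z * (zonalPoly d n).eval (z.1 : ℝ) * (zonalPoly d' m).eval (z.2 : ℝ) := by
  intro N ξ ζ
  obtain ⟨s, u, hu⟩ := exists_zonalPoly_inner_eq hd n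
    (fun k => (ξ k : EuclideanSpace ℝ (Fin (d + 1)))) fun k => norm_coe_uSphere (ξ k)
  obtain ⟨s', u', hu'⟩ := exists_zonalPoly_inner_eq hd' m
    (fun k => (ζ k : EuclideanSpace ℝ (Fin (d' + 1)))) fun k => norm_coe_uSphere (ζ k)
  exact quadForm_mul_gram_nonneg (quadForm_mul_gram_nonneg (hg N ξ ζ) hu) hu'

lemma measurePreserving_sphereInner_pair (hd : 1 ≤ d) {n : ℕ} {k l : Fin n} (hkl : k ≠ l) :
    MeasurePreserving (fun ξ : Fin n → USphere d => sphereInner (ξ k, ξ l))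
      (Measure.pi fun _ => sphereMeasure d) (ultraProb d) := by
  have hk := measurePreserving_eval (fun _ : Fin n => sphereMeasure d) k
  have hl := measurePreserving_eval (fun _ : Fin n => sphereMeasure d) l
  have hi := (ProbabilityTheory.iIndepFun_pi (μ := fun _ : Fin n => sphereMeasure d)
    (X := fun _ x => x) fun _ => aemeasurable_id).indepFun hkl
  have hp := (ProbabilityTheory.indepFun_iff_map_prod_eq_prod_map_map
    hk.measurable.aemeasurable hl.measurable.aemeasurable).1 hi
  have h1 : MeasurePreserving (fun ξ : Fin n → USphere d => (ξ k, ξ l))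
      (Measure.pi fun _ => sphereMeasure d) ((sphereMeasure d).prod (sphereMeasure d)) :=
    ⟨by fun_prop, by rw [hp]; exact congrArg₂ _ hk.map_eq hl.map_eq⟩
  exact MeasurePreserving.comp (g := sphereInner)
    ⟨continuous_sphereInner.measurable, map_sphereInner hd⟩ h1

lemma sphereInner_self (ξ : USphere d) : sphereInner (ξ, ξ) = ⟨1, by norm_num⟩ := by
  apply Subtype.ext
  simp [sphereInner]

lemma IsZonalPosDef.integral_nonneg (hd : 1 ≤ d) (hd' : 1 ≤ d') {g : UnitIcc × UnitIcc → ℝ}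
    (hg : IsZonalPosDef d d' g) (hc : Continuous g) :
    0 ≤ ∫ z, g z ∂((ultraProb d).prod (ultraProb d')) := by
  have := isProbabilityMeasure_ultraProb hd
  have := isProbabilityMeasure_ultraProb hd'
  set I := ∫ z, g z ∂((ultraProb d).prod (ultraProb d')) with hI
  set D := g (⟨1, by norm_num⟩, ⟨1, by norm_num⟩) with hD
  have key : ∀ n : ℕ, 0 ≤ (n : ℝ) * D + n * (n - 1) * I := by
    intro n
    let P := (Measure.pi fun _ : Fin n => sphereMeasure d).prod
      (Measure.pi fun _ : Fin n => sphereMeasure d')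
    have hcont : ∀ k l : Fin n, Continuous fun x : (Fin n → USphere d) × (Fin n → USphere d') =>
        g (sphereInner (x.1 k, x.1 l), sphereInner (x.2 k, x.2 l)) := by
      intro k l
      refine hc.comp ((continuous_sphereInner.comp ?_).prodMk (continuous_sphereInner.comp ?_)) <;>
        fun_prop
    have hint : ∀ k l : Fin n, Integrable (fun x : (Fin n → USphere d) × (Fin n → USphere d') =>
        g (sphereInner (x.1 k, x.1 l), sphereInner (x.2 k, x.2 l))) P := fun k l =>
      (hcont k l).integrable_of_hasCompactSupport (HasCompactSupport.of_compactSpace _)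
    have h0 : 0 ≤ ∫ x, ∑ k, ∑ l, g (sphereInner (x.1 k, x.1 l), sphereInner (x.2 k, x.2 l)) ∂P :=
      MeasureTheory.integral_nonneg fun x => by simpa using hg n x.1 x.2 1
    rw [integral_finsetSum _ fun k _ => integrable_finsetSum _ fun l _ => hint k l] at h0
    have h1 : ∀ k l : Fin n, ∫ x, g (sphereInner (x.1 k, x.1 l), sphereInner (x.2 k, x.2 l)) ∂P =
        (if k = l then D else I) := by
      intro k l
      split_ifs with h
      · subst h
        simp [sphereInner_self, hD]
      · have hmp := (measurePreserving_sphereInner_pair hd h).prod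
          (measurePreserving_sphereInner_pair hd' h)
        rw [hI, ← hmp.map_eq, integral_map hmp.measurable.aemeasurable hc.aestronglyMeasurable]
        rfl
    refine h0.trans_eq ?_
    have h2 : ∀ k l : Fin n, (if k = l then D else I) = I + (if k = l then D - I else 0) := by
      intro k l
      split_ifs <;> ring
    simp_rw [integral_finsetSum _ fun l _ => hint _ l, h1, h2, Finset.sum_add_distrib]
    simp
    ring
  by_contra! hneg
  obtain ⟨n, hn⟩ := exists_nat_gt (D / -I + 1)
  have hI' : 0 < -I := by linarith
  have h1 : D < ((n : ℝ) - 1) * -I := by rw [← div_lt_iff₀ hI']; linarith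
  have hD0 : 0 ≤ D := by simpa using key 1
  have hn0 : (0 : ℝ) < n := by have := div_nonneg hD0 hI'.le; linarith
  have := key n
  nlinarith

end Positivity

/-! ### Integration on the square and the expansion -/

section Square

/-- The square `[-1, 1]²`. -/
abbrev UnitSq : Type := UnitIcc × UnitIcc

/-- Integration of continuous functions on a compact space as a continuous linear functional. -/
noncomputable def integralFunctional {K : Type*} [TopologicalSpace K] [CompactSpace K]
    [MeasurableSpace K] [OpensMeasurableSpace K] (P : Measure K) [IsFiniteMeasure P] :
    C(K, ℝ) →L[ℝ] ℝ :=
  LinearMap.mkContinuous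
    { toFun := fun h => ∫ z, h z ∂P
      map_add' := fun g h => integral_add
        (g.continuous.integrable_of_hasCompactSupport (HasCompactSupport.of_compactSpace g))
        (h.continuous.integrable_of_hasCompactSupport (HasCompactSupport.of_compactSpace h))
      map_smul' := fun a _ => integral_const_mul a _ }
    (P.real Set.univ) fun h => by
      rw [mul_comm]
      exact norm_integral_le_of_norm_le_const (Eventually.of_forall h.norm_coe_le_norm)

lemma integralFunctional_apply {K : Type*} [TopologicalSpace K] [CompactSpace K]
    [MeasurableSpace K] [OpensMeasurableSpace K] (P : Measure K) [IsFiniteMeasure P]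
    (h : C(K, ℝ)) : integralFunctional P h = ∫ z, h z ∂P := rfl

/-- A polynomial in the first variable. -/
noncomputable def evalFst : ℝ[X] →ₐ[ℝ] C(UnitSq, ℝ) :=
  aeval ⟨fun z => (z.1 : ℝ), by fun_prop⟩

/-- A polynomial in the second variable. -/
noncomputable def evalSnd : ℝ[X] →ₐ[ℝ] C(UnitSq, ℝ) :=
  aeval ⟨fun z => (z.2 : ℝ), by fun_prop⟩

@[simp] lemma evalFst_apply (p : ℝ[X]) (z : UnitSq) : evalFst p z = p.eval (z.1 : ℝ) := by
  rw [evalFst, Polynomial.aeval_continuousMap_apply]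
  rfl

@[simp] lemma evalSnd_apply (p : ℝ[X]) (z : UnitSq) : evalSnd p z = p.eval (z.2 : ℝ) := by
  rw [evalSnd, Polynomial.aeval_continuousMap_apply]
  rfl

/-- The function `(x, y) ↦ c_n(d, x) c_m(d', y)` on the square. -/
noncomputable def zonalTensor (d d' : ℕ) (q : ℕ × ℕ) : C(UnitSq, ℝ) :=
  evalFst (zonalPoly d q.1) * evalSnd (zonalPoly d' q.2)

lemma zonalTensor_apply (d d' : ℕ) (q : ℕ × ℕ) (z : UnitSq) :
    zonalTensor d d' q z = (zonalPoly d q.1).eval (z.1 : ℝ) * (zonalPoly d' q.2).eval (z.2 : ℝ) := by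
  simp [zonalTensor]

lemma abs_zonalPoly_eval_le_one {d : ℕ} (hd : 1 ≤ d) (n : ℕ) {t : ℝ} (ht : t ∈ Set.Icc (-1 : ℝ) 1) :
    |(zonalPoly d n).eval t| ≤ 1 := by
  have h0 : (0 : Fin (d + 1)) ≠ Fin.last d := by
    intro h
    have := congrArg Fin.val h
    simp at this
    omega
  let e : EuclideanSpace ℝ (Fin (d + 1)) := EuclideanSpace.single 0 1
  let e' : EuclideanSpace ℝ (Fin (d + 1)) := EuclideanSpace.single (Fin.last d) 1
  have hee : ⟪e, e⟫ = 1 := by simp [e]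
  have hee' : ⟪e, e'⟫ = 0 := by
    simp only [e, e', EuclideanSpace.inner_single_left]
    simp [h0]
  have he'e : ⟪e', e⟫ = 0 := by rw [real_inner_comm, hee']
  have he'e' : ⟪e', e'⟫ = 1 := by simp [e']
  let v : EuclideanSpace ℝ (Fin (d + 1)) := t • e + Real.sqrt (1 - t ^ 2) • e'
  have hev : ⟪e, v⟫ = t := by
    simp only [v, inner_add_right, inner_smul_right, hee, hee']
    ring
  have hvv : ⟪v, v⟫ = 1 := by
    simp only [v, inner_add_right, inner_add_left, inner_smul_right, inner_smul_left, hee, hee',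
      he'e, he'e']
    simp [Real.mul_self_sqrt (one_sub_sq_nonneg ht)]
    ring
  have hn : ∀ w : EuclideanSpace ℝ (Fin (d + 1)), ⟪w, w⟫ = 1 → ‖w‖ = 1 := fun w hw => by
    rw [real_inner_self_eq_norm_sq] at hw
    exact (pow_eq_one_iff_of_nonneg (norm_nonneg w) two_ne_zero).1 hw
  obtain ⟨s, u, hu⟩ := exists_zonalPoly_inner_eq hd n ![e, v] fun k => by
    fin_cases k
    · exact hn e hee
    · exact hn v hvv
  have a00 := hu 0 0
  have a01 := hu 0 1
  have a11 := hu 1 1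
  simp only [Matrix.cons_val_zero, Matrix.cons_val_one, hee, hev, hvv, zonalPoly_eval_one hd] at a00 a01 a11
  rw [a01]
  calc |∑ α ∈ s, u 0 α * u 1 α| ≤ ∑ α ∈ s, (u 0 α * u 0 α + u 1 α * u 1 α) / 2 := by
        refine (Finset.abs_sum_le_sum_abs _ _).trans (Finset.sum_le_sum fun α _ => ?_)
        rw [abs_le]
        constructor <;> nlinarith [sq_nonneg (u 0 α - u 1 α), sq_nonneg (u 0 α + u 1 α)]
    _ = 1 := by
        rw [← Finset.sum_div, Finset.sum_add_distrib, ← a00, ← a11]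
        norm_num

lemma norm_zonalTensor_le_one {d d' : ℕ} (hd : 1 ≤ d) (hd' : 1 ≤ d') (q : ℕ × ℕ) :
    ‖zonalTensor d d' q‖ ≤ 1 := by
  refine (ContinuousMap.norm_le _ zero_le_one).2 fun z => ?_
  rw [zonalTensor_apply, norm_mul]
  exact mul_le_one₀ (abs_zonalPoly_eval_le_one hd _ z.1.2) (norm_nonneg _)
    (abs_zonalPoly_eval_le_one hd' _ z.2.2)

/-- The cone generated by the zonal polynomials contains the powers of `1 + X`. -/
lemma one_add_X_pow_nonneg {d : ℕ} (hd : 1 ≤ d) (N : ℕ) :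
    ∀ L : ℝ[X] →ₗ[ℝ] ℝ, (∀ n, 0 ≤ L (zonalPoly d n)) → 0 ≤ L ((1 + X) ^ N) := by
  induction N with
  | zero => exact fun L hL => by simpa [zonalPoly_zero] using hL 0
  | succ N ih =>
    intro L hL
    have := ih (L ∘ₗ LinearMap.mulLeft ℝ (1 + X)) fun n => ?_
    · simpa [pow_succ'] using this
    simp only [LinearMap.comp_apply, LinearMap.mulLeft_apply, add_mul, one_mul, map_add]
    refine add_nonneg (hL n) ?_
    rcases n with _ | n
    · simpa [zonalPoly_zero, zonalPoly_one] using hL 1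
    · have h := zonalPoly_rec hd n
      rw [mul_assoc] at h
      apply_fun L at h
      simp only [← Polynomial.smul_eq_C_mul, map_sub, map_smul, smul_eq_mul] at h
      have h1 := mul_nonneg (by positivity : (0 : ℝ) ≤ (n + d : ℝ)) (hL (n + 2))
      have h2 := mul_nonneg (by positivity : (0 : ℝ) ≤ (n + 1 : ℝ)) (hL n)
      have h3 : (0 : ℝ) < 2 * n + d + 1 := by positivity
      refine nonneg_of_mul_nonneg_right ?_ h3
      linarith

/-- A continuous function whose integrals against powers of `(1 + x)(1 + y)` are nonnegative is
nonnegative at `(1, 1)`. -/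
lemma nonneg_apply_one_one {P : Measure UnitSq} [IsFiniteMeasure P] [P.IsOpenPosMeasure]
    {h : C(UnitSq, ℝ)} (hh : ∀ N : ℕ, 0 ≤ integralFunctional P
      (h * evalSnd ((1 + X) ^ N) * evalFst ((1 + X) ^ N))) :
    0 ≤ h (⟨1, by norm_num⟩, ⟨1, by norm_num⟩) := by
  set o : UnitSq := (⟨1, by norm_num⟩, ⟨1, by norm_num⟩) with ho
  have hlim := tendsto_setIntegral_pow_smul_of_unique_maximum_of_isCompact_of_measure_nhdsWithin_pos
    (μ := P) (s := Set.univ) (c := fun z : UnitSq => (1 + (z.1 : ℝ)) * (1 + (z.2 : ℝ))) (g := h)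
    (x₀ := o) isCompact_univ
    (fun u hu hu' => by
      rw [Set.inter_univ]
      exact hu.measure_pos P ⟨o, hu'⟩) (by fun_prop)
    (fun z _ hz => by
      have h1 := z.1.2
      have h2 := z.2.2
      have : (z.1 : ℝ) < 1 ∨ (z.2 : ℝ) < 1 := by
        by_contra! hcon
        exact hz (Prod.ext (Subtype.ext (le_antisymm h1.2 hcon.1))
          (Subtype.ext (le_antisymm h2.2 hcon.2)))
      simp only [ho]
      rcases this with h | h <;> nlinarith [h1.1, h1.2, h2.1, h2.2])
    (fun z _ => mul_nonneg (by linarith [z.1.2.1]) (by linarith [z.2.2.1]))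
    (by simp [ho]) (Set.mem_univ _)
    (by exact (h.continuous.integrable_of_hasCompactSupport
      (HasCompactSupport.of_compactSpace h)).integrableOn)
    h.continuous.continuousWithinAt
  refine ge_of_tendsto' hlim fun N => ?_
  rw [Measure.restrict_univ, smul_eq_mul]
  refine mul_nonneg (inv_nonneg.2 (integral_nonneg fun z => pow_nonneg
    (mul_nonneg (by linarith [z.1.2.1]) (by linarith [z.2.2.1])) _)) ((hh N).trans_eq ?_)
  rw [integralFunctional_apply]
  refine integral_congr_ae (Eventually.of_forall fun z => ?_)
  simp only [smul_eq_mul, mul_pow, ContinuousMap.mul_apply, evalSnd_apply, evalFst_apply,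
    eval_pow, eval_add, eval_one, eval_X]
  ring

end Square

section Expansion

variable (d d' : ℕ) [Fact (1 ≤ d)] [Fact (1 ≤ d')]

instance : IsProbabilityMeasure (ultraProb d) := isProbabilityMeasure_ultraProb Fact.out

instance : (ultraProb d).IsOpenPosMeasure := by
  have := isOpenPosMeasure_ultraMeasure d
  have := isFiniteMeasure_ultraMeasure (Fact.out : 1 ≤ d)
  rw [ultraProb]
  exact Measure.isOpenPosMeasure_smul _ (ENNReal.inv_ne_zero.2 (measure_ne_top _ _))

/-- Integration over the square with respect to the normalized ultraspherical measures. -/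
noncomputable def squareIntegral : C(UnitSq, ℝ) →L[ℝ] ℝ :=
  integralFunctional ((ultraProb d).prod (ultraProb d'))

lemma squareIntegral_apply (h : C(UnitSq, ℝ)) :
    squareIntegral d d' h = ∫ z, h z ∂((ultraProb d).prod (ultraProb d')) := rfl

/-- The expansion coefficients of a continuous function on the square. -/
noncomputable def squareCoef (h : C(UnitSq, ℝ)) (q : ℕ × ℕ) : ℝ :=
  NNdim q.1 d * NNdim q.2 d' * squareIntegral d d' (h * zonalTensor d d' q)

lemma integral_zonalPoly_mul (n m : ℕ) :
    ∫ x : UnitIcc, (zonalPoly d n).eval (x : ℝ) * (zonalPoly d m).eval (x : ℝ) ∂(ultraProb d) =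
      if n = m then (NNdim n d)⁻¹ else 0 := by
  have hd : 1 ≤ d := Fact.out
  have h : ∫ x : UnitIcc, (zonalPoly d n).eval (x : ℝ) * (zonalPoly d m).eval (x : ℝ)
      ∂(ultraMeasure d) = ultraFunctional d (zonalPoly d n * zonalPoly d m) := by
    simp [ultraFunctional]
  rw [integral_ultraProb, h]
  split_ifs with hnm
  · subst hnm
    have := NNdim_mul_ultraFunctional_sq hd n
    have h1 := (ultraFunctional_one_pos hd).ne'
    have h2 := (NNdim_pos hd n).ne'
    field_simp
    linarith
  · rw [ultraFunctional_zonalPoly_mul_of_ne hd hnm, mul_zero]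

lemma squareIntegral_zonalTensor_mul (q r : ℕ × ℕ) :
    squareIntegral d d' (zonalTensor d d' q * zonalTensor d d' r) =
      if q = r then (NNdim q.1 d * NNdim q.2 d')⁻¹ else 0 := by
  have : ∀ z : UnitSq, (zonalTensor d d' q * zonalTensor d d' r) z =
      ((zonalPoly d q.1).eval (z.1 : ℝ) * (zonalPoly d r.1).eval (z.1 : ℝ)) *
      ((zonalPoly d' q.2).eval (z.2 : ℝ) * (zonalPoly d' r.2).eval (z.2 : ℝ)) := fun z => by
    rw [ContinuousMap.mul_apply, zonalTensor_apply, zonalTensor_apply]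
    ring
  simp_rw [squareIntegral_apply, this]
  rw [integral_prod_mul (fun x : UnitIcc => (zonalPoly d q.1).eval (x : ℝ) *
    (zonalPoly d r.1).eval (x : ℝ)) (fun y : UnitIcc => (zonalPoly d' q.2).eval (y : ℝ) *
    (zonalPoly d' r.2).eval (y : ℝ)), integral_zonalPoly_mul, integral_zonalPoly_mul, mul_inv]
  simp only [Prod.ext_iff]
  split_ifs <;> simp_all

variable {d d'}

lemma squareCoef_zonalTensor (q r : ℕ × ℕ) :
    squareCoef d d' (zonalTensor d d' q) r = if q = r then 1 else 0 := by
  have h1 := (NNdim_pos (Fact.out : 1 ≤ d) q.1).ne'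
  have h2 := (NNdim_pos (Fact.out : 1 ≤ d') q.2).ne'
  rw [squareCoef, squareIntegral_zonalTensor_mul]
  split_ifs with h
  · subst h
    field_simp
  · simp

lemma squareCoef_nonneg {h : C(UnitSq, ℝ)} (hh : IsZonalPosDef d d' h) (q : ℕ × ℕ) :
    0 ≤ squareCoef d d' h q := by
  have hd : 1 ≤ d := Fact.out
  have hd' : 1 ≤ d' := Fact.out
  refine mul_nonneg (mul_nonneg (NNdim_pos hd _).le (NNdim_pos hd' _).le) ?_
  have := (hh.mul_zonalPoly hd hd' q.1 q.2).integral_nonneg hd hd'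
    (by have := continuous_eval_coe; fun_prop)
  refine this.trans_eq (integral_congr_ae (Eventually.of_forall fun z => ?_))
  simp [zonalTensor_apply, mul_assoc]

/-- The coefficients as a linear functional. -/
noncomputable def squareCoefFunctional (d d' : ℕ) [Fact (1 ≤ d)] [Fact (1 ≤ d')] (q : ℕ × ℕ) : C(UnitSq, ℝ) →L[ℝ] ℝ :=
  (NNdim q.1 d * NNdim q.2 d') •
    (squareIntegral d d').comp ((ContinuousLinearMap.mul ℝ C(UnitSq, ℝ)).flip (zonalTensor d d' q))

lemma squareCoefFunctional_apply (q : ℕ × ℕ) (h : C(UnitSq, ℝ)) :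
    squareCoefFunctional d d' q h = squareCoef d d' h q := by
  rw [squareCoefFunctional, squareCoef]
  rfl

/-- A function with nonnegative coefficients is nonnegative at `(1, 1)`. -/
lemma nonneg_apply_of_squareCoef_nonneg {h : C(UnitSq, ℝ)} (hh : ∀ q, 0 ≤ squareCoef d d' h q) :
    0 ≤ h (⟨1, by norm_num⟩, ⟨1, by norm_num⟩) := by
  have hd : 1 ≤ d := Fact.out
  have hd' : 1 ≤ d' := Fact.out
  refine nonneg_apply_one_one (P := (ultraProb d).prod (ultraProb d')) fun N => ?_
  refine one_add_X_pow_nonneg hd N ((squareIntegral d d').toLinearMap ∘ₗ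
    LinearMap.mulLeft ℝ (h * evalSnd ((1 + X) ^ N)) ∘ₗ evalFst.toLinearMap) fun n => ?_
  have := one_add_X_pow_nonneg hd' N ((squareIntegral d d').toLinearMap ∘ₗ
    LinearMap.mulLeft ℝ (h * evalFst (zonalPoly d n)) ∘ₗ evalSnd.toLinearMap) fun m => ?_
  · refine this.trans_eq ?_
    simp only [LinearMap.comp_apply, LinearMap.mulLeft_apply, AlgHom.toLinearMap_apply]
    rw [mul_right_comm]
  · have h1 := mul_pos (NNdim_pos hd n) (NNdim_pos hd' m)
    have := nonneg_of_mul_nonneg_right (hh (n, m)) h1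
    simpa [zonalTensor, mul_assoc] using this

lemma sum_squareCoef_le {h : C(UnitSq, ℝ)} (hh : ∀ q, 0 ≤ squareCoef d d' h q)
    (F : Finset (ℕ × ℕ)) :
    ∑ q ∈ F, squareCoef d d' h q ≤ h (⟨1, by norm_num⟩, ⟨1, by norm_num⟩) := by
  have := nonneg_apply_of_squareCoef_nonneg (d := d) (d' := d')
    (h := h - ∑ q ∈ F, squareCoef d d' h q • zonalTensor d d' q) fun r => ?_
  · simpa [zonalTensor_apply, zonalPoly_eval_one (Fact.out : 1 ≤ d),
      zonalPoly_eval_one (Fact.out : 1 ≤ d')] using this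
  · rw [← squareCoefFunctional_apply]
    simp only [map_sub, map_sum, map_smul, squareCoefFunctional_apply, squareCoef_zonalTensor]
    by_cases hr : r ∈ F <;> simp [hr, hh r]

lemma summable_squareCoef {h : C(UnitSq, ℝ)} (hh : ∀ q, 0 ≤ squareCoef d d' h q) :
    Summable (squareCoef d d' h) :=
  summable_of_sum_le hh (sum_squareCoef_le hh)

lemma eq_zero_of_integral_zonalPoly_eq_zero {g : C(UnitIcc, ℝ)}
    (hg : ∀ n, ∫ x, g x * (zonalPoly d n).eval (x : ℝ) ∂(ultraProb d) = 0) : g = 0 := by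
  let Φ : C(UnitIcc, ℝ) →L[ℝ] ℝ :=
    (integralFunctional (ultraProb d)).comp (ContinuousLinearMap.mul ℝ C(UnitIcc, ℝ) g)
  have hΦ : ∀ k, Φ k = ∫ x, g x * k x ∂(ultraProb d) := fun k => rfl
  have hpoly : ∀ q : ℝ[X], Φ (q.toContinuousMapOnAlgHom (Set.Icc (-1 : ℝ) 1)) = 0 := by
    intro q
    have hq := mem_span_zonalPoly (Fact.out : 1 ≤ d) q
    induction hq using Submodule.span_induction with
    | mem q hq =>
      obtain ⟨n, rfl⟩ := hq
      exact hg n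
    | zero => rw [map_zero, map_zero]
    | add p q _ _ hp hq => rw [map_add, map_add, hp, hq, add_zero]
    | smul a p _ hp => rw [map_smul, map_smul, hp, smul_zero]
  have hgg : Φ g = 0 := by
    have hmem := continuousMap_mem_polynomialFunctions_closure (-1) 1 g
    refine closure_minimal (t := {k | Φ k = 0}) ?_ (isClosed_eq Φ.continuous continuous_const) hmem
    intro k hk
    obtain ⟨q, rfl⟩ := (polynomialFunctions_coe (Set.Icc (-1 : ℝ) 1)).subset hk
    exact hpoly q
  rw [hΦ, integral_eq_zero_iff_of_nonneg (fun x => mul_self_nonneg (g x))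
    (integrable_ultraProb Fact.out (by fun_prop))] at hgg
  have := (Continuous.ae_eq_iff_eq (ultraProb d) (by fun_prop) continuous_const).1 hgg
  ext x
  exact mul_self_eq_zero.1 (congrFun this x)

lemma eq_zero_of_squareCoef_eq_zero {h : C(UnitSq, ℝ)} (hh : ∀ q, squareCoef d d' h q = 0) :
    h = 0 := by
  have hd : 1 ≤ d := Fact.out
  have hd' : 1 ≤ d' := Fact.out
  have hc := fun m => continuous_eval_coe (zonalPoly d' m)
  have hc' := fun m => continuous_eval_coe (zonalPoly d m)
  let H : ℕ → C(UnitIcc, ℝ) := fun m =>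
    ⟨fun x => ∫ y, h (x, y) * (zonalPoly d' m).eval (y : ℝ) ∂(ultraProb d'), by
      refine (continuous_parametric_integral_of_continuous (μ := ultraProb d')
        (f := fun x y => h (x, y) * (zonalPoly d' m).eval (y : ℝ)) (s := Set.univ) ?_
        isCompact_univ).congr fun x => by rw [Measure.restrict_univ]
      have := hc m
      simp only [Function.uncurry_def]
      fun_prop⟩
  have hH : ∀ m, H m = 0 := fun m => by
    refine eq_zero_of_integral_zonalPoly_eq_zero (d := d) fun n => ?_
    have h1 := mul_pos (NNdim_pos hd n) (NNdim_pos hd' m)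
    have h2 := (mul_eq_zero.1 (hh (n, m))).resolve_left h1.ne'
    rw [squareIntegral_apply, integral_prod _
      ((ContinuousMap.continuous _).integrable_of_hasCompactSupport
        (HasCompactSupport.of_compactSpace _))] at h2
    rw [← h2]
    refine integral_congr_ae (Eventually.of_forall fun x => ?_)
    simp only [H, ContinuousMap.coe_mk]
    rw [← integral_mul_const]
    refine integral_congr_ae (Eventually.of_forall fun y => ?_)
    simp only [ContinuousMap.mul_apply, zonalTensor_apply]
    ring
  ext ⟨x, y⟩
  have : (⟨fun y => h (x, y), by fun_prop⟩ : C(UnitIcc, ℝ)) = 0 :=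
    eq_zero_of_integral_zonalPoly_eq_zero (d := d') fun m => DFunLike.congr_fun (hH m) x
  exact DFunLike.congr_fun this y

/-- The expansion of a continuous function with nonnegative coefficients. -/
lemma hasSum_squareCoef {h : C(UnitSq, ℝ)} (hh : ∀ q, 0 ≤ squareCoef d d' h q) :
    HasSum (fun q => squareCoef d d' h q • zonalTensor d d' q) h := by
  have hs : Summable fun q => squareCoef d d' h q • zonalTensor d d' q := by
    refine Summable.of_norm_bounded (summable_squareCoef hh) fun q => ?_
    rw [norm_smul, Real.norm_of_nonneg (hh q)]
    exact mul_le_of_le_one_right (hh q) (norm_zonalTensor_le_one Fact.out Fact.out q)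
  convert hs.hasSum
  rw [← sub_eq_zero]
  refine eq_zero_of_squareCoef_eq_zero (d := d) (d' := d') fun r => ?_
  rw [← squareCoefFunctional_apply, map_sub, (squareCoefFunctional d d' r).map_tsum hs]
  simp [squareCoefFunctional_apply, squareCoef_zonalTensor]

end Expansion

/-! ### The main theorem -/

section Main

lemma real_inner_mem_Icc {E : Type*} [NormedAddCommGroup E] [InnerProductSpace ℝ E] {v w : E}
    (hv : ‖v‖ = 1) (hw : ‖w‖ = 1) : ⟪v, w⟫ ∈ Set.Icc (-1 : ℝ) 1 := by
  have := abs_real_inner_le_norm v w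
  rw [hv, hw, one_mul] at this
  exact abs_le.1 this

/-- The restriction to the square of a function continuous there. -/
def squareRestrict (f : ℝ → ℝ → ℝ) (hf : ContinuousOn (fun p : ℝ × ℝ => f p.1 p.2)
    (Set.Icc (-1 : ℝ) 1 ×ˢ Set.Icc (-1 : ℝ) 1)) : C(UnitSq, ℝ) :=
  ⟨fun z => f z.1 z.2, hf.comp_continuous (f := fun z : UnitSq => ((z.1 : ℝ), (z.2 : ℝ)))
    (by fun_prop) fun z => ⟨z.1.2, z.2.2⟩⟩

variable {d d' : ℕ} {f : ℝ → ℝ → ℝ}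

lemma NNdim_mul_sigmaS_div (hd : 1 ≤ d) (n : ℕ) :
    NNdim n d * sigmaS (d - 1) / sigmaS d = NNdim n d * (ultraFunctional d 1)⁻¹ := by
  have h1 := (sigmaS_pos (d - 1)).ne'
  have h2 := (ultraFunctional_one_pos hd).ne'
  rw [← ultraFunctional_one hd]
  field_simp

lemma twoSphereCoef_eq_squareCoef [Fact (1 ≤ d)] [Fact (1 ≤ d')]
    (hf : ContinuousOn (fun p : ℝ × ℝ => f p.1 p.2)
      (Set.Icc (-1 : ℝ) 1 ×ˢ Set.Icc (-1 : ℝ) 1)) (q : ℕ × ℕ) :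
    twoSphereCoef d d' f q.1 q.2 = squareCoef d d' (squareRestrict f hf) q := by
  have hd : 1 ≤ d := Fact.out
  have hd' : 1 ≤ d' := Fact.out
  have inner : ∀ x : ℝ, ∫ y in (-1 : ℝ)..1, f x y * ultraC d q.1 x * ultraC d' q.2 y *
        (1 - x ^ 2) ^ ((d : ℝ) / 2 - 1) * (1 - y ^ 2) ^ ((d' : ℝ) / 2 - 1) =
      (∫ y : UnitIcc, f x y * ultraC d q.1 x * ultraC d' q.2 y ∂(ultraMeasure d')) *
        ultraWeight d x := fun x => by
    rw [← integral_mul_const]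
    exact (integral_ultraMeasure d' fun y =>
      f x y * ultraC d q.1 x * ultraC d' q.2 y * ultraWeight d x).symm
  rw [twoSphereCoef, squareCoef, squareIntegral_apply, integral_prod _
    ((ContinuousMap.continuous _).integrable_of_hasCompactSupport
      (HasCompactSupport.of_compactSpace _)), NNdim_mul_sigmaS_div hd, NNdim_mul_sigmaS_div hd']
  simp_rw [inner, integral_ultraProb]
  rw [← integral_ultraMeasure d fun x =>
    ∫ y : UnitIcc, f x y * ultraC d q.1 x * ultraC d' q.2 y ∂(ultraMeasure d'),
    integral_const_mul]
  simp_rw [ultraC_eq_zonalPoly hd, ultraC_eq_zonalPoly hd', ContinuousMap.mul_apply,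
    zonalTensor_apply, mul_assoc]
  simp only [squareRestrict, ContinuousMap.coe_mk]
  ring

lemma IsPosDefTwoSpheres.isZonalPosDef (h : IsPosDefTwoSpheres d d' f) :
    IsZonalPosDef d d' (squareRestrict f h.1) := fun n ξ ζ a =>
  h.2 n (fun k => ξ k) (fun k => ζ k) (fun _ => norm_coe_uSphere _) (fun _ => norm_coe_uSphere _) a

lemma IsPosDefTwoSpheres.hasSum [Fact (1 ≤ d)] [Fact (1 ≤ d')] (h : IsPosDefTwoSpheres d d' f) :
    HasSum (fun q : ℕ × ℕ => twoSphereCoef d d' f q.1 q.2 • zonalTensor d d' q)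
      (squareRestrict f h.1) := by
  simp_rw [twoSphereCoef_eq_squareCoef h.1]
  exact hasSum_squareCoef (squareCoef_nonneg h.isZonalPosDef)

lemma IsPosDefTwoSpheres.of_hasSum (hd : 1 ≤ d) (hd' : 1 ≤ d')
    (hf : ContinuousOn (fun p : ℝ × ℝ => f p.1 p.2)
      (Set.Icc (-1 : ℝ) 1 ×ˢ Set.Icc (-1 : ℝ) 1)) {c : ℕ → ℕ → ℝ} (hc : ∀ n m, 0 ≤ c n m)
    (hsum : ∀ x ∈ Set.Icc (-1 : ℝ) 1, ∀ y ∈ Set.Icc (-1 : ℝ) 1,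
      HasSum (fun p : ℕ × ℕ => c p.1 p.2 * ultraC d p.1 x * ultraC d' p.2 y) (f x y)) :
    IsPosDefTwoSpheres d d' f := by
  refine ⟨hf, fun n ξ ζ hξ hζ a => ?_⟩
  have hs := hasSum_sum (s := Finset.univ) fun k _ => hasSum_sum (s := Finset.univ) fun l _ =>
    ((hsum _ (real_inner_mem_Icc (hξ k) (hξ l)) _
      (real_inner_mem_Icc (hζ k) (hζ l))).mul_right (a k)).mul_right (a l)
  refine hs.nonneg fun q => ?_
  obtain ⟨s, u, hu⟩ := exists_zonalPoly_inner_eq hd q.1 ξ hξ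
  obtain ⟨s', u', hu'⟩ := exists_zonalPoly_inner_eq hd' q.2 ζ hζ
  simp_rw [ultraC_eq_zonalPoly hd, ultraC_eq_zonalPoly hd']
  refine quadForm_mul_gram_nonneg (quadForm_mul_gram_nonneg (fun b => ?_) hu) hu' a
  have : ∑ k, ∑ l, c q.1 q.2 * b k * b l = c q.1 q.2 * (∑ k, b k) ^ 2 := by
    rw [sq, Finset.sum_mul_sum, Finset.mul_sum]
    simp only [Finset.mul_sum, mul_assoc]
  rw [this]
  exact mul_nonneg (hc _ _) (sq_nonneg _)

end Main

/-- Theorem 2.9 of Guella–Menegatto–Peron (Theorem 6.1 of Berg–Porcu): a continuous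
`f : [-1,1]² → ℝ` belongs to `𝒫(S^d, S^{d'})` iff
`f(x,y) = ∑_{n,m} f̂_{n,m} c_n(d,x) c_m(d',y)` with `f̂_{n,m} ≥ 0` and `∑ f̂_{n,m} < ∞`; in
that case the expansion converges uniformly and the coefficients are given by the stated
double integral. -/
theorem isPosDefTwoSpheres_iff (d d' : ℕ) (hd : 1 ≤ d) (hd' : 1 ≤ d') (f : ℝ → ℝ → ℝ)
    (hf : ContinuousOn (fun p : ℝ × ℝ => f p.1 p.2)
      (Set.Icc (-1 : ℝ) 1 ×ˢ Set.Icc (-1 : ℝ) 1)) :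
    (IsPosDefTwoSpheres d d' f ↔
      ∃ c : ℕ → ℕ → ℝ, (∀ n m, 0 ≤ c n m) ∧ (Summable fun p : ℕ × ℕ => c p.1 p.2) ∧
        ∀ x ∈ Set.Icc (-1 : ℝ) 1, ∀ y ∈ Set.Icc (-1 : ℝ) 1,
          HasSum (fun p : ℕ × ℕ => c p.1 p.2 * ultraC d p.1 x * ultraC d' p.2 y) (f x y)) ∧
    (IsPosDefTwoSpheres d d' f →
      (∀ x ∈ Set.Icc (-1 : ℝ) 1, ∀ y ∈ Set.Icc (-1 : ℝ) 1,
        HasSum (fun p : ℕ × ℕ =>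
          twoSphereCoef d d' f p.1 p.2 * ultraC d p.1 x * ultraC d' p.2 y) (f x y)) ∧
      TendstoUniformlyOn
        (fun N (p : ℝ × ℝ) => ∑ q ∈ Finset.range N ×ˢ Finset.range N,
          twoSphereCoef d d' f q.1 q.2 * ultraC d q.1 p.1 * ultraC d' q.2 p.2)
        (fun p : ℝ × ℝ => f p.1 p.2) atTop
        (Set.Icc (-1 : ℝ) 1 ×ˢ Set.Icc (-1 : ℝ) 1)) := by
  have : Fact (1 ≤ d) := ⟨hd⟩
  have : Fact (1 ≤ d') := ⟨hd'⟩
  have hpt : IsPosDefTwoSpheres d d' f →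
      ∀ x ∈ Set.Icc (-1 : ℝ) 1, ∀ y ∈ Set.Icc (-1 : ℝ) 1, HasSum (fun p : ℕ × ℕ =>
        twoSphereCoef d d' f p.1 p.2 * ultraC d p.1 x * ultraC d' p.2 y) (f x y) := by
    intro h x hx y hy
    have := h.hasSum.mapL (ContinuousMap.evalCLM ℝ ((⟨x, hx⟩, ⟨y, hy⟩) : UnitSq))
    simpa [zonalTensor_apply, ultraC_eq_zonalPoly hd, ultraC_eq_zonalPoly hd', squareRestrict,
      mul_assoc] using this
  refine ⟨⟨fun h => ?_, ?_⟩, fun h => ⟨hpt h, ?_⟩⟩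
  · have hnn := squareCoef_nonneg h.isZonalPosDef
    refine ⟨twoSphereCoef d d' f, fun n m => ?_, ?_, hpt h⟩
    · exact (hnn (n, m)).trans_eq (twoSphereCoef_eq_squareCoef h.1 (n, m)).symm
    · simp_rw [twoSphereCoef_eq_squareCoef h.1]
      exact summable_squareCoef hnn
  · rintro ⟨c, hc, -, hsum⟩
    exact IsPosDefTwoSpheres.of_hasSum hd hd' hf hc hsum
  · have hN : Tendsto (fun N => Finset.range N ×ˢ Finset.range N) atTop atTop :=
      tendsto_atTop_finset_of_monotone
        (fun a b hab => Finset.product_subset_product (Finset.range_mono hab)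
          (Finset.range_mono hab))
        fun q => ⟨max q.1 q.2 + 1, by simp⟩
    rw [Metric.tendstoUniformlyOn_iff]
    intro ε hε
    filter_upwards [(Metric.tendsto_nhds.1 (h.hasSum.comp hN)) ε hε] with N hNε p hp
    have hle := ContinuousMap.dist_apply_le_dist (f := squareRestrict f h.1)
      (g := ∑ q ∈ Finset.range N ×ˢ Finset.range N,
        twoSphereCoef d d' f q.1 q.2 • zonalTensor d d' q)
      ((⟨p.1, hp.1⟩, ⟨p.2, hp.2⟩) : UnitSq)
    rw [dist_comm] at hNε
    refine lt_of_eq_of_lt ?_ (hle.trans_lt hNε)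
    simp [zonalTensor_apply, ultraC_eq_zonalPoly hd, ultraC_eq_zonalPoly hd', squareRestrict,
      mul_assoc]
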